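/- Let V ⊆ C^m × C^s be a purely m-dimensional algebraic variety with proper projection onto C^m, let L : C^s → C be a C-linear form such that the generic fibers over C^m of the projections of V and of Φ_L(V) = {(u, L(v)) : (u,v) ∈ V} have the same cardinality, and let P_L ∈ (C[y])[z] be the optimal (unitary) polynomial describing the hypersurface Φ_L(V) ⊆ C^m × C. Let f₁,…,f_m, f_{m+1},…,f_{m+s} be holomorphic functions on a domain U ⊆ C^n whose joint image lies in V, with R_L(f₁,…,f_m) ≢ 0 where R_L is the discriminant of P_L, and set f̃ = L(f_{m+1},…,f_{m+s}). Suppose (f₁^ν),…,(f_m^ν),(f̃^ν) are sequences of holomorphic functions on U converging locally uniformly to f₁,…,f_m, f̃ respectively with P_L(f₁^ν,…,f_m^ν, f̃^ν) = 0 for every ν. Then there exist sequences of holomorphic functions (f_{m+1}^ν),…,(f_{m+s}^ν) on U converging locally uniformly to f_{m+1},…,f_{m+s} such that the image of (f₁^ν,…,f_m^ν, f_{m+1}^ν,…,f_{m+s}^ν) is contained in V for every sufficiently large ν. -/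

import Mathlib

open Filter Topology

/-- `X` is an analytic subset of `Ω`: near every point of `Ω` it is the common zero set
of finitely many holomorphic functions. -/
def IsAnalyticIn {E : Type} [NormedAddCommGroup E] [NormedSpace ℂ E] (Ω X : Set E) : Prop :=
  X ⊆ Ω ∧ ∀ z ∈ Ω, ∃ U : Set E, IsOpen U ∧ z ∈ U ∧ ∃ (N : ℕ) (g : Fin N → E → ℂ),
    (∀ i, DifferentiableOn ℂ (g i) U) ∧ X ∩ U = {x ∈ U | ∀ i, g i x = 0}

/-- `x` is a regular point of `X` of (complex) dimension `d`: near `x`, after a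
`ℂ`-linear change of coordinates, `X` is the graph of a holomorphic map defined on an
open subset of `ℂ^d`. -/
def IsRegPtOfDim {E : Type} [NormedAddCommGroup E] [NormedSpace ℂ E]
    (d : ℕ) (X : Set E) (x : E) : Prop :=
  ∃ U : Set E, IsOpen U ∧ x ∈ U ∧
    ∃ (e : ℕ) (L : E ≃L[ℂ] ((Fin d → ℂ) × (Fin e → ℂ)))
      (Ω : Set (Fin d → ℂ)) (g : (Fin d → ℂ) → (Fin e → ℂ)),
      IsOpen Ω ∧ DifferentiableOn ℂ g Ω ∧
      L '' (X ∩ U) = {p : (Fin d → ℂ) × (Fin e → ℂ) | p.1 ∈ Ω ∧ p.2 = g p.1}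

/-- `X` has pure dimension `d`: regular points (necessarily of dimension `d`) are dense in `X`. -/
def PureDim {E : Type} [NormedAddCommGroup E] [NormedSpace ℂ E] (X : Set E) (d : ℕ) : Prop :=
  (∀ x ∈ X, x ∈ closure {y | y ∈ X ∧ IsRegPtOfDim d X y}) ∧
  (∀ e : ℕ, ∀ x ∈ X, IsRegPtOfDim e X x → e = d)

/-- `d` is the dimension of `X`: the maximum of the dimensions at regular points. -/
def SetDimIs {E : Type} [NormedAddCommGroup E] [NormedSpace ℂ E] (X : Set E) (d : ℕ) : Prop :=
  (∃ x ∈ X, IsRegPtOfDim d X x) ∧ ∀ e : ℕ, ∀ x ∈ X, IsRegPtOfDim e X x → e ≤ d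

/-- The natural projection restricted to `Y` is proper over `U`. -/
def ProperProjOn {A B : Type} [TopologicalSpace A] [TopologicalSpace B]
    (U : Set A) (Y : Set (A × B)) : Prop :=
  ∀ K ⊆ U, IsCompact K → IsCompact {p | p ∈ Y ∧ p.1 ∈ K}

/-- The projection `π|_Y` is regular (an analytic isomorphism) at `p`:
near `p`, `Y` is the graph of a holomorphic map. -/
def ProjRegularAt {A B : Type} [NormedAddCommGroup A] [NormedSpace ℂ A]
    [NormedAddCommGroup B] [NormedSpace ℂ B] (Y : Set (A × B)) (p : A × B) : Prop :=
  ∃ W : Set A, IsOpen W ∧ p.1 ∈ W ∧ ∃ g : A → B, DifferentiableOn ℂ g W ∧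
    ∃ V : Set (A × B), IsOpen V ∧ p ∈ V ∧
      Y ∩ V = {q : A × B | q.1 ∈ W ∧ q.2 = g q.1} ∩ V

/-- The set `S(Y, π)` of singular points of the projection `π|_Y`. -/
def SingProj {A B : Type} [NormedAddCommGroup A] [NormedSpace ℂ A]
    [NormedAddCommGroup B] [NormedSpace ℂ B] (Y : Set (A × B)) : Set (A × B) :=
  {p | p ∈ Y ∧ ¬ ProjRegularAt Y p}

/-- `X` is irreducible as an analytic subset of `Ω`. -/
def IrredAnalyticIn {E : Type} [NormedAddCommGroup E] [NormedSpace ℂ E] (Ω X : Set E) : Prop :=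
  IsAnalyticIn Ω X ∧ X.Nonempty ∧
    ∀ X₁ X₂ : Set E, IsAnalyticIn Ω X₁ → IsAnalyticIn Ω X₂ → X = X₁ ∪ X₂ → X = X₁ ∨ X = X₂

/-- `C` is an irreducible analytic component of `X` (inside `Ω`). -/
def IsIrredComp {E : Type} [NormedAddCommGroup E] [NormedSpace ℂ E] (Ω X C : Set E) : Prop :=
  IrredAnalyticIn Ω C ∧ C ⊆ X ∧
    ∀ C' : Set E, IrredAnalyticIn Ω C' → C ⊆ C' → C' ⊆ X → C' = C

/-- `Z` has generic fiber cardinality `s` over `E`: outside a proper analytic subset of `E`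
every fiber of the projection has exactly `s` points. -/
def GenFiberCard {A B : Type} [NormedAddCommGroup A] [NormedSpace ℂ A]
    (E : Set A) (Z : Set (A × B)) (s : ℕ) : Prop :=
  ∃ T : Set A, IsAnalyticIn E T ∧ T ≠ E ∧ ∀ x ∈ E \ T, Set.ncard {v : B | (x, v) ∈ Z} = s

/-- An algebraic subset of `ℂ^N`. -/
def IsAlgSet (N : ℕ) (V : Set (Fin N → ℂ)) : Prop :=
  ∃ (q : ℕ) (ps : Fin q → MvPolynomial (Fin N) ℂ),
    V = {y | ∀ i, MvPolynomial.eval y (ps i) = 0}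

/-- A Nash function on an open set `U ⊆ ℂ^N`. -/
def NashFn (N : ℕ) (U : Set (Fin N → ℂ)) (f : (Fin N → ℂ) → ℂ) : Prop :=
  DifferentiableOn ℂ f U ∧ ∀ x₀ ∈ U, ∃ V : Set (Fin N → ℂ), IsOpen V ∧ x₀ ∈ V ∧
    ∃ P : Polynomial (MvPolynomial (Fin N) ℂ), P ≠ 0 ∧
      ∀ x ∈ V ∩ U, Polynomial.eval₂ (MvPolynomial.eval x) (f x) P = 0

/-- `X` is a Nash subset of `Ω ⊆ ℂ^N`. -/
def IsNashIn (N : ℕ) (Ω X : Set (Fin N → ℂ)) : Prop :=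
  X ⊆ Ω ∧ ∀ z ∈ Ω, ∃ U : Set (Fin N → ℂ), IsOpen U ∧ z ∈ U ∧
    ∃ (q : ℕ) (g : Fin q → (Fin N → ℂ) → ℂ),
      (∀ i, NashFn N U (g i)) ∧ X ∩ U = {x ∈ U | ∀ i, g i x = 0}

/-- Evaluation of a unitary polynomial `P ∈ (ℂ[y₁,…,y_m])[z]` at `(u, z)`. -/
noncomputable def pEval {m : ℕ} (u : Fin m → ℂ) (z : ℂ)
    (P : Polynomial (MvPolynomial (Fin m) ℂ)) : ℂ :=
  Polynomial.eval₂ (MvPolynomial.eval u) z P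

section ComplexLines

open Set

variable {E F : Type*} [NormedAddCommGroup E] [NormedSpace ℂ E]
  [NormedAddCommGroup F] [NormedSpace ℂ F]

theorem isOpen_line_preimage {O : Set E} (hO : IsOpen O) (x w : E) :
    IsOpen {ζ : ℂ | x + ζ • w ∈ O} :=
  hO.preimage (by fun_prop)

theorem isPreconnected_line_preimage_ball (c x w : E) (r : ℝ) :
    IsPreconnected {ζ : ℂ | x + ζ • w ∈ Metric.ball c r} := by
  apply Convex.isPreconnected
  intro a ha b hb s t hs ht hst
  have := (convex_ball c r) ha hb hs ht hst
  simp only [mem_ofPred_eq] at *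
  convert! this using 1
  have : x = (s + t) • x := by simp [hst]
  nth_rw 1 [this]
  simp only [smul_add, add_smul, smul_assoc]
  abel

theorem differentiableOn_line {O : Set E} {g : E → F} (hg : DifferentiableOn ℂ g O) (x w : E) :
    DifferentiableOn ℂ (fun ζ : ℂ => g (x + ζ • w)) {ζ : ℂ | x + ζ • w ∈ O} :=
  hg.comp (by fun_prop) fun _ h => h

/-- The identity theorem in several complex variables. -/
theorem frequently_ne_zero_of_isPreconnected {U : Set E} (hU : IsOpen U) (hUc : IsPreconnected U)
    {h : E → ℂ} (hh : DifferentiableOn ℂ h U) (hne : ∃ x ∈ U, h x ≠ 0) {x : E} (hx : x ∈ U) :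
    ∃ᶠ y in 𝓝 x, h y ≠ 0 := by
  intro hx0
  obtain ⟨p, hpU, hp⟩ := hne
  have hS : U ⊆ {x | ∀ᶠ y in 𝓝 x, h y = 0} := by
    refine hUc.subset_of_closure_inter_subset isOpen_setOfPred_eventually_nhds
      ⟨x, hx, by simpa using hx0⟩ ?_
    rintro a ⟨ha, haU⟩
    obtain ⟨ρ, hρ, hball⟩ := Metric.isOpen_iff.1 hU a haU
    obtain ⟨y, hy, hyS⟩ := mem_closure_iff_nhds.1 ha _ (Metric.ball_mem_nhds a hρ)
    refine Filter.eventually_of_mem (Metric.ball_mem_nhds a hρ) fun z hz => ?_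
    have hd := differentiableOn_line (hh.mono hball) y (z - y)
    have hk := (hd.analyticOnNhd (isOpen_line_preimage Metric.isOpen_ball y (z - y)))
      |>.eqOn_zero_of_preconnected_of_eventuallyEq_zero
        (isPreconnected_line_preimage_ball a y (z - y) ρ) (z₀ := 0) (by simpa using hy) ?_
    · simpa using hk (show (1 : ℂ) ∈ _ by simpa using hz)
    · have : Tendsto (fun ζ : ℂ => y + ζ • (z - y)) (𝓝 0) (𝓝 y) := by
        apply Continuous.tendsto' (by fun_prop); simp
      exact this.eventually hyS
  exact hp (hS hpU).self_of_nhds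

/-- Around every point there is a family of parallel complex discs whose boundary circles avoid the
zero set of a given nonzero holomorphic function. -/
theorem exists_disc_family {U : Set E} (hU : IsOpen U) (hUc : IsPreconnected U)
    {h : E → ℂ} (hh : DifferentiableOn ℂ h U) (hne : ∃ x ∈ U, h x ≠ 0) {x₀ : E} (hx₀ : x₀ ∈ U)
    {O : Set E} (hO : O ∈ 𝓝 x₀) :
    ∃ (w : E) (r δ : ℝ), 0 < r ∧ 0 < δ ∧ ∀ x ∈ Metric.ball x₀ δ,
      (∀ ζ ∈ Metric.closedBall (0 : ℂ) r, x + ζ • w ∈ O) ∧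
      (∀ ζ ∈ Metric.sphere (0 : ℂ) r, h (x + ζ • w) ≠ 0) := by
  obtain ⟨ρ, hρ, hball⟩ := Metric.mem_nhds_iff.1 (inter_mem hO (hU.mem_nhds hx₀))
  obtain ⟨y, hy0, hy⟩ := ((frequently_ne_zero_of_isPreconnected hU hUc hh hne hx₀).and_eventually
    (Metric.ball_mem_nhds x₀ hρ)).exists
  set w := y - x₀ with hw
  have hd := (differentiableOn_line (hh.mono fun z hz => (hball hz).2) x₀ w).analyticOnNhd
    (isOpen_line_preimage Metric.isOpen_ball x₀ w)
  have h0 : (0 : ℂ) ∈ {ζ : ℂ | x₀ + ζ • w ∈ Metric.ball x₀ ρ} := by simpa using hρ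
  have hpun : ∀ᶠ ζ in 𝓝[≠] (0 : ℂ), h (x₀ + ζ • w) ≠ 0 := by
    rcases (hd 0 h0).eventually_eq_zero_or_eventually_ne_zero with h1 | h1
    · exfalso
      have := hd.eqOn_zero_of_preconnected_of_eventuallyEq_zero
        (isPreconnected_line_preimage_ball x₀ x₀ w ρ) h0 h1
        (show (1 : ℂ) ∈ _ by simpa [hw, dist_eq_norm] using hy)
      exact hy0 (by simpa [hw] using this)
    · exact h1
  have hin : ∀ᶠ ζ in 𝓝 (0 : ℂ), x₀ + ζ • w ∈ Metric.ball x₀ ρ :=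
    (isOpen_line_preimage Metric.isOpen_ball x₀ w).mem_nhds h0
  obtain ⟨r', hr', hr⟩ := Metric.eventually_nhds_iff_ball.1 (hin.and
    (eventually_nhdsWithin_iff.1 hpun))
  set r := r' / 2
  have hrpos : 0 < r := by positivity
  have hcl : Metric.closedBall (0 : ℂ) r ⊆ Metric.ball 0 r' :=
    Metric.closedBall_subset_ball (by simp only [r]; linarith)
  have hopen : IsOpen {p : E | p ∈ Metric.ball x₀ ρ ∧ h p ≠ 0} := by
    have := (hh.continuousOn.mono fun z hz => (hball hz).2).isOpen_inter_preimage
      Metric.isOpen_ball (isOpen_compl_singleton (x := (0 : ℂ)))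
    exact this
  have e1 : ∀ᶠ x in 𝓝 x₀, ∀ ζ ∈ Metric.closedBall (0 : ℂ) r, x + ζ • w ∈ Metric.ball x₀ ρ := by
    apply (isCompact_closedBall (0 : ℂ) r).eventually_forall_of_forall_eventually
    intro ζ hζ
    have : Tendsto (fun p : E × ℂ => p.1 + p.2 • w) (𝓝 (x₀, ζ)) (𝓝 (x₀ + ζ • w)) :=
      Continuous.tendsto' (by fun_prop) _ _ rfl
    exact this.eventually (Metric.isOpen_ball.mem_nhds (hr ζ (hcl hζ)).1)
  have e2 : ∀ᶠ x in 𝓝 x₀, ∀ ζ ∈ Metric.sphere (0 : ℂ) r,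
      x + ζ • w ∈ {p : E | p ∈ Metric.ball x₀ ρ ∧ h p ≠ 0} := by
    apply (isCompact_sphere (0 : ℂ) r).eventually_forall_of_forall_eventually
    intro ζ hζ
    have : Tendsto (fun p : E × ℂ => p.1 + p.2 • w) (𝓝 (x₀, ζ)) (𝓝 (x₀ + ζ • w)) :=
      Continuous.tendsto' (by fun_prop) _ _ rfl
    have hζ' := hr ζ (hcl (Metric.sphere_subset_closedBall hζ))
    refine this.eventually (hopen.mem_nhds ⟨hζ'.1, hζ'.2 ?_⟩)
    exact Metric.ne_of_mem_sphere hζ hrpos.ne'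
  obtain ⟨δ, hδ, hb⟩ := Metric.eventually_nhds_iff_ball.1 (e1.and e2)
  exact ⟨w, r, δ, hrpos, hδ, fun x hx => ⟨fun ζ hζ => (hball ((hb x hx).1 ζ hζ)).1,
    fun ζ hζ => ((hb x hx).2 ζ hζ).2⟩⟩

/-- Riemann's extension theorem in one variable, across the zero set of a holomorphic function. -/
theorem exists_differentiableOn_extension_of_complex [CompleteSpace F] {Ω : Set ℂ} (hΩ : IsOpen Ω)
    (hΩc : IsPreconnected Ω) {k : ℂ → ℂ} (hk : DifferentiableOn ℂ k Ω) (hne : ∃ z ∈ Ω, k z ≠ 0)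
    {φ : ℂ → F} (hφ : DifferentiableOn ℂ φ (Ω ∩ {z | k z ≠ 0})) {C : ℝ}
    (hC : ∀ z ∈ Ω, k z ≠ 0 → ‖φ z‖ ≤ C) :
    ∃ Φ : ℂ → F, DifferentiableOn ℂ Φ Ω ∧ ∀ z ∈ Ω, k z ≠ 0 → Φ z = φ z := by
  have hopen : IsOpen (Ω ∩ {z | k z ≠ 0}) :=
    hk.continuousOn.isOpen_inter_preimage hΩ (isOpen_compl_singleton (x := (0 : ℂ)))
  have hlim : ∀ z ∈ Ω, k z ≠ 0 → limUnder (𝓝[≠] z) φ = φ z := fun z hz hz0 =>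
    ((hφ.differentiableAt (hopen.mem_nhds ⟨hz, hz0⟩)).continuousAt.tendsto.mono_left
      nhdsWithin_le_nhds).limUnder_eq
  refine ⟨fun z => limUnder (𝓝[≠] z) φ, fun c hc => ?_, hlim⟩
  have hpun : ∀ᶠ z in 𝓝[≠] c, k z ≠ 0 := by
    have han := hk.analyticOnNhd hΩ
    rcases (han c hc).eventually_eq_zero_or_eventually_ne_zero with h1 | h1
    · obtain ⟨z, hz, hz0⟩ := hne
      exact absurd (han.eqOn_zero_of_preconnected_of_eventuallyEq_zero hΩc hc h1 hz) hz0
    · exact h1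
  obtain ⟨r, hr, hrb⟩ := Metric.eventually_nhds_iff_ball.1 ((hΩ.eventually_mem hc).and
    (eventually_nhdsWithin_iff.1 hpun))
  have hs := Metric.ball_mem_nhds c hr
  have hsub : Metric.ball c r \ {c} ⊆ Ω ∩ {z | k z ≠ 0} := fun z hz =>
    ⟨(hrb z hz.1).1, (hrb z hz.1).2 hz.2⟩
  have hupd := Complex.differentiableOn_update_limUnder_of_bddAbove hs (hφ.mono hsub)
    ⟨C, by rintro _ ⟨z, hz, rfl⟩; exact hC z (hsub hz).1 (hsub hz).2⟩
  refine DifferentiableAt.differentiableWithinAt ((hupd.differentiableAt hs).congr_of_eventuallyEq ?_)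
  refine Filter.eventually_of_mem hs fun z hz => ?_
  by_cases hzc : z = c
  · subst hzc; simp
  · have := hsub ⟨hz, hzc⟩
    simp [hzc, hlim z this.1 this.2]

end ComplexLines

section Extension

open Set

variable {E F : Type*} [NormedAddCommGroup E] [NormedSpace ℂ E]
  [NormedAddCommGroup F] [NormedSpace ℂ F]

theorem differentiableAt_circleAverage [FiniteDimensional ℂ E] [FiniteDimensional ℂ F]
    {O : Set E} (hO : IsOpen O)
    {g : E → F} (hg : DifferentiableOn ℂ g O) {C : ℝ} (hC : ∀ x ∈ O, ‖g x‖ ≤ C) {x₀ w : E}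
    {r δ : ℝ} (hr : 0 ≤ r) (hδ : 0 < δ)
    (hsub : ∀ x ∈ Metric.ball x₀ δ, ∀ ζ ∈ Metric.sphere (0 : ℂ) r, x + ζ • w ∈ O) :
    DifferentiableAt ℂ (fun x => Real.circleAverage (fun ζ => g (x + ζ • w)) 0 r) x₀ := by
  borelize E
  have : CompleteSpace F := FiniteDimensional.complete ℂ F
  have : ProperSpace (E →L[ℂ] F) := FiniteDimensional.proper ℂ _
  have hδ2 : 0 < δ / 2 := by positivity
  have hmem : ∀ x ∈ Metric.ball x₀ δ, ∀ θ : ℝ, x + circleMap 0 r θ • w ∈ O := fun x hx θ =>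
    hsub x hx _ (circleMap_mem_sphere 0 hr θ)
  have hcont : ∀ x ∈ Metric.ball x₀ δ, Continuous (fun θ : ℝ => g (x + circleMap 0 r θ • w)) :=
    fun x hx => hg.continuousOn.comp_continuous (by fun_prop) (hmem x hx)
  have hdiff : ∀ x ∈ Metric.ball x₀ δ, ∀ θ : ℝ, HasFDerivAt (fun x => g (x + circleMap 0 r θ • w))
      (fderiv ℂ g (x + circleMap 0 r θ • w)) x := fun x hx θ => by
    have := (hg.differentiableAt (hO.mem_nhds (hmem x hx θ))).hasFDerivAt
    exact (hasFDerivAt_comp_add_right (𝕜 := ℂ) (f := g) (circleMap 0 r θ • w)).2 this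
  have hbound : ∀ x ∈ Metric.ball x₀ (δ / 2), ∀ θ : ℝ,
      ‖fderiv ℂ g (x + circleMap 0 r θ • w)‖ ≤ (C + C) / (δ / 2) := fun x hx θ => by
    have hballO : Metric.ball (x + circleMap 0 r θ • w) (δ / 2) ⊆ O := fun y hy => by
      have := hmem (y - circleMap 0 r θ • w) ?_ θ
      · simpa using this
      · have h1 : dist (y - circleMap 0 r θ • w) x < δ / 2 := by
          rw [Metric.mem_ball, dist_eq_norm] at hy
          rw [dist_eq_norm]
          convert! hy using 2
          abel
        have := dist_triangle (y - circleMap 0 r θ • w) x x₀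
        rw [Metric.mem_ball] at hx ⊢
        linarith
    refine Complex.norm_fderiv_le_div_of_mapsTo_ball (hg.mono hballO) (fun y hy => ?_) hδ2
    rw [Metric.mem_closedBall, dist_eq_norm]
    exact (norm_sub_le _ _).trans (add_le_add (hC _ (hballO hy))
      (hC _ (hballO (Metric.mem_ball_self hδ2))))
  have hsub2 : Metric.ball x₀ (δ / 2) ⊆ Metric.ball x₀ δ := Metric.ball_subset_ball (by linarith)
  have key := intervalIntegral.hasFDerivAt_integral_of_dominated_of_fderiv_le
    (μ := MeasureTheory.volume) (a := 0) (b := 2 * Real.pi)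
    (F := fun x θ => g (x + circleMap 0 r θ • w))
    (F' := fun x θ => fderiv ℂ g (x + circleMap 0 r θ • w)) (bound := fun _ => (C + C) / (δ / 2))
    (Metric.ball_mem_nhds x₀ hδ2)
    (Filter.eventually_of_mem (Metric.ball_mem_nhds x₀ hδ)
      fun x hx => (hcont x hx).aestronglyMeasurable)
    ((hcont x₀ (Metric.mem_ball_self hδ)).intervalIntegrable _ _)
    ((measurable_fderiv ℂ g).comp (Continuous.measurable (by fun_prop))).aestronglyMeasurable
    (Filter.Eventually.of_forall fun θ _ x hx => hbound x hx θ)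
    intervalIntegrable_const
    (Filter.Eventually.of_forall fun θ _ x hx => hdiff x (hsub2 hx) θ)
  unfold Real.circleAverage
  exact (key.differentiableAt).const_smul _

/-- Riemann's extension theorem in several complex variables. -/
theorem exists_differentiableOn_extension [FiniteDimensional ℂ E] [FiniteDimensional ℂ F]
    {U : Set E} (hU : IsOpen U) (hUc : IsPreconnected U)
    {h : E → ℂ} (hh : DifferentiableOn ℂ h U) (hne : ∃ x ∈ U, h x ≠ 0)
    {g : E → F} (hg : DifferentiableOn ℂ g (U ∩ {x | h x ≠ 0}))
    (hb : ∀ x ∈ U, ∃ C : ℝ, ∀ᶠ y in 𝓝 x, h y ≠ 0 → ‖g y‖ ≤ C) :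
    ∃ G : E → F, DifferentiableOn ℂ G U ∧ ∀ x ∈ U, h x ≠ 0 → G x = g x := by
  have : CompleteSpace F := FiniteDimensional.complete ℂ F
  have local_ext : ∀ x₀ ∈ U, ∃ G : E → F,
      ∀ᶠ x in 𝓝 x₀, DifferentiableAt ℂ G x ∧ (h x ≠ 0 → G x = g x) := by
    intro x₀ hx₀
    obtain ⟨C, hC⟩ := hb x₀ hx₀
    obtain ⟨ρ, hρ, hball⟩ := Metric.eventually_nhds_iff_ball.1 ((hU.eventually_mem hx₀).and hC)
    obtain ⟨w, r, δ, hr, hδ, hdisc⟩ :=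
      exists_disc_family hU hUc hh hne hx₀ (Metric.ball_mem_nhds x₀ hρ)
    have hhb : DifferentiableOn ℂ h (Metric.ball x₀ ρ) := hh.mono fun z hz => (hball z hz).1
    have hOopen : IsOpen (Metric.ball x₀ ρ ∩ {x | h x ≠ 0}) :=
      hhb.continuousOn.isOpen_inter_preimage Metric.isOpen_ball (isOpen_compl_singleton (x := (0:ℂ)))
    have hgO : DifferentiableOn ℂ g (Metric.ball x₀ ρ ∩ {x | h x ≠ 0}) :=
      hg.mono fun z hz => ⟨(hball z hz.1).1, hz.2⟩
    refine ⟨fun x => Real.circleAverage (fun ζ => g (x + ζ • w)) 0 r,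
      Filter.eventually_of_mem (Metric.ball_mem_nhds x₀ hδ) fun x hx => ⟨?_, fun hx0 => ?_⟩⟩
    · obtain ⟨δ', hδ', hsub⟩ := Metric.isOpen_iff.1 Metric.isOpen_ball x hx
      refine differentiableAt_circleAverage hOopen hgO
        (fun y hy => (hball y hy.1).2 hy.2) hr.le hδ' fun y hy ζ hζ =>
        ⟨(hdisc y (hsub hy)).1 ζ (Metric.sphere_subset_closedBall hζ), (hdisc y (hsub hy)).2 ζ hζ⟩
    · set Ω := {ζ : ℂ | x + ζ • w ∈ Metric.ball x₀ ρ}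
      have h0 : (0 : ℂ) ∈ Ω := (hdisc x hx).1 0 (by simpa using hr.le)
      obtain ⟨Φ, hΦ, hΦg⟩ := exists_differentiableOn_extension_of_complex
        (isOpen_line_preimage Metric.isOpen_ball x w) (isPreconnected_line_preimage_ball x₀ x w ρ)
        (differentiableOn_line hhb x w) ⟨0, h0, by simpa using hx0⟩
        (φ := fun ζ => g (x + ζ • w))
        (differentiableOn_line hgO x w)
        (C := C) (fun ζ hζ hζ0 => (hball _ hζ).2 hζ0)
      have hcl : Metric.closedBall (0 : ℂ) r ⊆ Ω := (hdisc x hx).1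
      have hav : Real.circleAverage Φ 0 r = Φ 0 := by
        refine DiffContOnCl.circleAverage (DifferentiableOn.diffContOnCl (hΦ.mono ?_))
        rw [abs_of_pos hr, closure_ball _ hr.ne']
        exact hcl
      have h1 : Real.circleAverage (fun ζ => g (x + ζ • w)) 0 r = Real.circleAverage Φ 0 r := by
        apply Real.circleAverage_congr_sphere
        rw [abs_of_pos hr]
        intro ζ hζ
        exact (hΦg ζ (hcl (Metric.sphere_subset_closedBall hζ)) ((hdisc x hx).2 ζ hζ)).symm
      simp only [h1, hav]
      simpa using hΦg 0 h0 (by simpa using hx0)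
  choose! G hG using local_ext
  refine ⟨fun x => G x x, fun x hx => ?_, fun x hx hx0 => (hG x hx).self_of_nhds.2 hx0⟩
  refine DifferentiableAt.differentiableWithinAt
    ((hG x hx).self_of_nhds.1.congr_of_eventuallyEq ?_)
  filter_upwards [(hG x hx).eventually_nhds, hU.eventually_mem hx] with y hy hyU
  have c1 := hy.self_of_nhds.1.continuousAt.tendsto
  have c2 := (hG y hyU).self_of_nhds.1.continuousAt.tendsto
  refine tendsto_nhds_unique_of_frequently_eq c2 c1 ?_
  refine ((frequently_ne_zero_of_isPreconnected hU hUc hh hne hyU).and_eventually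
    (hy.and (hG y hyU))).mono ?_
  rintro z ⟨hz, hz1, hz2⟩
  rw [hz1.2 hz, hz2.2 hz]

/-- Complements of proper analytic hypersurfaces in connected open sets are connected. -/
theorem isPreconnected_inter_ne_zero [FiniteDimensional ℂ E]
    {U : Set E} (hU : IsOpen U) (hUc : IsPreconnected U)
    {h : E → ℂ} (hh : DifferentiableOn ℂ h U) (hne : ∃ x ∈ U, h x ≠ 0) :
    IsPreconnected (U ∩ {x | h x ≠ 0}) := by
  classical
  have hopen : IsOpen (U ∩ {x | h x ≠ 0}) :=
    hh.continuousOn.isOpen_inter_preimage hU (isOpen_compl_singleton (x := (0 : ℂ)))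
  rw [isPreconnected_iff_subset_of_disjoint]
  intro A B hA hB hAB hdisj
  set χ : E → ℂ := fun x => if x ∈ A then 1 else 0 with hχ
  have hχd : DifferentiableOn ℂ χ (U ∩ {x | h x ≠ 0}) := by
    intro x hx
    apply DifferentiableAt.differentiableWithinAt
    rcases hAB hx with hxA | hxB
    · exact (differentiableAt_const (1 : ℂ)).congr_of_eventuallyEq
        (Filter.eventually_of_mem (hA.mem_nhds hxA) fun y hy => by simp only [hχ, if_pos hy])
    · refine (differentiableAt_const (0 : ℂ)).congr_of_eventuallyEq
        (Filter.eventually_of_mem ((hopen.inter hB).mem_nhds ⟨hx, hxB⟩) fun y hy => ?_)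
      have : y ∉ A := fun hyA => by
        have : y ∈ U ∩ {x | h x ≠ 0} ∩ (A ∩ B) := ⟨hy.1, hyA, hy.2⟩
        rw [hdisj] at this; exact this
      simp only [hχ, if_neg this]
  obtain ⟨G, hG, hGχ⟩ := exists_differentiableOn_extension hU hUc hh hne hχd fun x _ =>
    ⟨1, Filter.Eventually.of_forall fun y _ => by simp only [hχ]; split_ifs <;> simp⟩
  have h01 : ∀ x ∈ U, G x = 0 ∨ G x = 1 := by
    intro x hx
    have hc := (hG.differentiableAt (hU.mem_nhds hx)).continuousAt.tendsto
    have : G x * (G x - 1) = 0 := by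
      refine tendsto_nhds_unique_of_frequently_eq (hc.mul (hc.sub_const 1)) tendsto_const_nhds ?_
      refine ((frequently_ne_zero_of_isPreconnected hU hUc hh hne hx).and_eventually
        (hU.eventually_mem hx)).mono ?_
      rintro y ⟨hy0, hy⟩
      rw [hGχ y hy hy0]
      simp only [hχ]; split_ifs <;> simp
    rcases mul_eq_zero.1 this with h | h
    · exact Or.inl h
    · exact Or.inr (sub_eq_zero.1 h)
  have hsq := hUc.eq_one_or_eq_neg_one_of_sq_eq (f := fun x => 2 * G x - 1)
    ((hG.continuousOn.const_smul (2 : ℂ)).sub continuousOn_const) fun x hx => by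
      rcases h01 x hx with h | h <;> simp [h]; norm_num
  rcases hsq with h1 | h0
  · refine Or.inl fun x hx => ?_
    by_contra hxA
    have e1 := h1 hx.1
    have e2 : G x = 0 := by rw [hGχ x hx.1 hx.2]; simp only [hχ, if_neg hxA]
    simp only [e2, Pi.one_apply] at e1
    norm_num at e1
  · refine Or.inr fun x hx => (hAB hx).resolve_left fun hxA => ?_
    have e1 := h0 hx.1
    have e2 : G x = 1 := by rw [hGχ x hx.1 hx.2]; simp only [hχ, if_pos hxA]
    simp only [e2, Pi.neg_apply, Pi.one_apply] at e1
    norm_num at e1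

/-- Locally uniform convergence of holomorphic maps extends across hypersurfaces. -/
theorem tendstoLocallyUniformlyOn_of_inter_ne_zero [FiniteDimensional ℂ E]
    {U : Set E} (hU : IsOpen U) (hUc : IsPreconnected U)
    {h : E → ℂ} (hh : DifferentiableOn ℂ h U) (hne : ∃ x ∈ U, h x ≠ 0)
    {ι : Type*} {l : Filter ι} {G : ι → E → F} {g : E → F} (hG : ∀ i, DifferentiableOn ℂ (G i) U)
    (hg : DifferentiableOn ℂ g U)
    (hlim : TendstoLocallyUniformlyOn G g l (U ∩ {x | h x ≠ 0})) :
    TendstoLocallyUniformlyOn G g l U := by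
  have : ProperSpace E := FiniteDimensional.proper ℂ E
  have : LocallyCompactSpace E := inferInstance
  have hopen : IsOpen (U ∩ {x | h x ≠ 0}) :=
    hh.continuousOn.isOpen_inter_preimage hU (isOpen_compl_singleton (x := (0 : ℂ)))
  rw [tendstoLocallyUniformlyOn_iff_forall_isCompact hopen] at hlim
  rw [Metric.tendstoLocallyUniformlyOn_iff]
  intro ε hε x₀ hx₀
  obtain ⟨w, r, δ, hr, hδ, hdisc⟩ :=
    exists_disc_family hU hUc hh hne hx₀ (hU.mem_nhds hx₀)
  have hsub : Metric.closedBall x₀ (δ / 2) ⊆ Metric.ball x₀ δ :=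
    Metric.closedBall_subset_ball (by linarith)
  set K := (fun p : E × ℂ => p.1 + p.2 • w) ''
    (Metric.closedBall x₀ (δ / 2) ×ˢ Metric.sphere (0 : ℂ) r) with hKdef
  have hK : IsCompact K :=
    ((isCompact_closedBall _ _).prod (isCompact_sphere _ _)).image (by fun_prop)
  have hKsub : K ⊆ U ∩ {x | h x ≠ 0} := by
    rintro _ ⟨⟨x, ζ⟩, ⟨hx, hζ⟩, rfl⟩
    exact ⟨(hdisc x (hsub hx)).1 ζ (Metric.sphere_subset_closedBall hζ),
      (hdisc x (hsub hx)).2 ζ hζ⟩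
  refine ⟨Metric.closedBall x₀ (δ / 2),
    mem_nhdsWithin_of_mem_nhds (Metric.closedBall_mem_nhds x₀ (by positivity)), ?_⟩
  filter_upwards [Metric.tendstoUniformlyOn_iff.1 (hlim K hKsub hK) (ε / 2) (by positivity)]
    with i hi x hx
  have hd : DifferentiableOn ℂ (fun ζ : ℂ => g (x + ζ • w) - G i (x + ζ • w))
      (Metric.closedBall 0 r) :=
    (differentiableOn_line (hg.sub (hG i)) x w).mono (hdisc x (hsub hx)).1
  have hmax := Complex.norm_le_of_forall_mem_frontier_norm_le (U := Metric.ball (0 : ℂ) r)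
    (f := fun ζ : ℂ => g (x + ζ • w) - G i (x + ζ • w)) (C := ε / 2) Metric.isBounded_ball
    (DifferentiableOn.diffContOnCl (by rwa [closure_ball _ hr.ne'])) (fun ζ hζ => by
      rw [frontier_ball _ hr.ne'] at hζ
      rw [← dist_eq_norm]
      exact (hi _ ⟨(x, ζ), ⟨hx, hζ⟩, rfl⟩).le) (z := 0) (subset_closure (Metric.mem_ball_self hr))
  rw [dist_eq_norm]
  simp only [zero_smul, add_zero] at hmax
  linarith

end Extension

section Algebra

open Set

open MvPolynomial

/-- The substitution of the variable `y j` into polynomials with coefficients in `ℂ[x]`. -/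
noncomputable def fiberCoordHom {m s : ℕ} (j : Fin s) :
    Polynomial (MvPolynomial (Fin m) ℂ) →+* MvPolynomial (Fin m ⊕ Fin s) ℂ :=
  Polynomial.eval₂RingHom (rename (R := ℂ) (Sum.inl : Fin m → Fin m ⊕ Fin s)).toRingHom
    (X (Sum.inr j))

theorem eval_fiberCoordHom {m s : ℕ} (j : Fin s) (D : Polynomial (MvPolynomial (Fin m) ℂ))
    (u : Fin m → ℂ) (v : Fin s → ℂ) :
    eval (Sum.elim u v) (fiberCoordHom j D) = pEval u (v j) D := by
  have : (eval (Sum.elim u v)).comp (fiberCoordHom (m := m) j) =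
      Polynomial.eval₂RingHom (eval u) (v j) := by
    apply Polynomial.ringHom_ext'
    · ext i
      · simp [fiberCoordHom]
      · simp [fiberCoordHom]
    · simp [fiberCoordHom]
  exact RingHom.congr_fun this D

theorem finitePresentation_fiberCoordHom {m s : ℕ} (j : Fin s) :
    (fiberCoordHom (m := m) j).FinitePresentation := by
  rw [← RingHom.FinitePresentation.of_finiteType]
  have h : ((fiberCoordHom (m := m) j).comp (Polynomial.C.comp C)).FiniteType := by
    have : (fiberCoordHom (m := m) j).comp (Polynomial.C.comp C) =
        algebraMap ℂ (MvPolynomial (Fin m ⊕ Fin s) ℂ) := by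
      ext; simp [fiberCoordHom, MvPolynomial.algebraMap_eq]
    rw [this, RingHom.finiteType_algebraMap]
    infer_instance
  exact RingHom.FiniteType.of_comp_finiteType h

/-- If an affine variety has bounded fibres, then over every irreducible subvariety of the base each
fibre coordinate satisfies a nontrivial polynomial equation. -/
theorem exists_polynomial_of_bounded_fibers {m s q : ℕ}
    (ps : Fin q → MvPolynomial (Fin m ⊕ Fin s) ℂ) (j : Fin s)
    (hb : ∀ u : Fin m → ℂ, ∃ B : ℝ, ∀ v : Fin s → ℂ,
      (∀ i, eval (Sum.elim u v) (ps i) = 0) → ‖v j‖ ≤ B)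
    (p : Ideal (MvPolynomial (Fin m) ℂ)) [hp : p.IsPrime] :
    ∃ D : Polynomial (MvPolynomial (Fin m) ℂ), (∃ k, D.coeff k ∉ p) ∧
      ∀ u : Fin m → ℂ, (∀ a ∈ p, eval u a = 0) → ∀ v : Fin s → ℂ,
        (∀ i, eval (Sum.elim u v) (ps i) = 0) → pEval u (v j) D = 0 := by
  set P : Ideal (Polynomial (MvPolynomial (Fin m) ℂ)) := p.map Polynomial.C with hP
  have hPprime : P.IsPrime := Ideal.isPrime_map_C_of_isPrime
  have hmemP : ∀ D, D ∈ P ↔ ∀ k, D.coeff k ∈ p := fun D => Ideal.mem_map_C_iff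
  have hker : ∀ u : Fin m → ℂ, (∀ a ∈ p, eval u a = 0) → ∀ z, ∀ D ∈ P, pEval u z D = 0 := by
    intro u hu z D hD
    rw [pEval, Polynomial.eval₂_eq_sum, Polynomial.sum]
    exact Finset.sum_eq_zero fun k _ => by rw [hu _ ((hmemP D).1 hD k), zero_mul]
  set I := Ideal.span (Set.range ps) ⊔ P.map (fiberCoordHom j) with hI
  by_cases hdis : Disjoint (I : Set (MvPolynomial (Fin m ⊕ Fin s) ℂ))
      (P.primeCompl.map (fiberCoordHom j) : Submonoid _)
  · exfalso
    obtain ⟨𝔮, h𝔮, hI𝔮, hdis𝔮⟩ := Ideal.exists_le_prime_disjoint I _ hdis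
    have hcomap : 𝔮.comap (fiberCoordHom j) = P := by
      apply le_antisymm
      · intro D hD
        by_contra hDP
        exact Set.disjoint_left.1 hdis𝔮 hD ⟨D, hDP, rfl⟩
      · rw [← Ideal.map_le_iff_le_comap]
        exact le_sup_right.trans hI𝔮
    have hcons : IsConstructible (PrimeSpectrum.zeroLocus (𝔮 : Set (MvPolynomial (Fin m ⊕ Fin s) ℂ))) := by
      have h := (PrimeSpectrum.isRetrocompact_zeroLocus_compl_of_fg
        ((isNoetherianRing_iff_ideal_fg _).1 inferInstance 𝔮)).isConstructible
        (PrimeSpectrum.isClosed_zeroLocus _).isOpen_compl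
      simpa using h.compl
    obtain ⟨S, hS⟩ := PrimeSpectrum.exists_constructibleSetData_iff.2
      (PrimeSpectrum.isConstructible_comap_image (finitePresentation_fiberCoordHom (m := m) j) hcons)
    have hPS : (⟨P, hPprime⟩ : PrimeSpectrum _) ∈ S.toSet := by
      rw [hS]
      exact ⟨⟨𝔮, h𝔮⟩, fun x hx => hx, PrimeSpectrum.ext hcomap⟩
    simp only [PrimeSpectrum.ConstructibleSetData.toSet, Set.mem_iUnion] at hPS
    obtain ⟨C₀, hC₀, hPC⟩ := hPS
    have hQ : C₀.f ∉ P := fun h => hPC.2 (by simpa using h)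
    have hg : ∀ i, C₀.g i ∈ P := fun i => hPC.1 ⟨i, rfl⟩
    obtain ⟨k, hk⟩ : ∃ k, C₀.f.coeff k ∉ p := by
      by_contra! h
      exact hQ ((hmemP _).2 h)
    rw [← IsPrime.vanishingIdeal_zeroLocus (K := ℂ) p, mem_vanishingIdeal_iff] at hk
    push Not at hk
    obtain ⟨u, hu, huk⟩ := hk
    have hu' : ∀ a ∈ p, eval u a = 0 := fun a ha => by simpa [aeval_eq_eval] using hu a ha
    have hQ0 : C₀.f.map (eval u) ≠ 0 := fun h => huk (by
      have := congrArg (fun r => Polynomial.coeff r k) h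
      simpa [aeval_eq_eval] using this)
    obtain ⟨B, hB⟩ := hb u
    obtain ⟨z, hzB, hz⟩ : ∃ z : ℂ, B < ‖z‖ ∧ pEval u z C₀.f ≠ 0 := by
      have hinf : ({z : ℂ | B < ‖z‖}).Infinite := by
        intro hfin
        obtain ⟨M, hM⟩ := hfin.isBounded.exists_norm_le
        have h1 := hM ((|B| + |M| + 1 : ℝ) : ℂ) (by
          simp only [Set.mem_ofPred_eq, Complex.norm_real, Real.norm_eq_abs]
          rw [abs_of_pos (by positivity)]
          have := le_abs_self B
          have := abs_nonneg M
          linarith)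
        rw [Complex.norm_real, Real.norm_eq_abs, abs_of_pos (by positivity)] at h1
        have := le_abs_self M
        have := abs_nonneg B
        linarith
      obtain ⟨z, hz, hzr⟩ := hinf.exists_notMem_finset (C₀.f.map (eval u)).roots.toFinset
      refine ⟨z, hz, fun h0 => hzr ?_⟩
      rw [Multiset.mem_toFinset, Polynomial.mem_roots hQ0, Polynomial.IsRoot, Polynomial.eval_map]
      exact h0
    set e := Polynomial.eval₂RingHom (eval u) z with he
    have heP : ∀ D, e D = pEval u z D := fun D => rfl
    have hkerS : (⟨RingHom.ker e, RingHom.ker_isPrime e⟩ : PrimeSpectrum _) ∈ S.toSet := by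
      simp only [PrimeSpectrum.ConstructibleSetData.toSet, Set.mem_iUnion]
      refine ⟨C₀, hC₀, ?_, ?_⟩
      · rintro _ ⟨i, rfl⟩
        exact hker u hu' z _ (hg i)
      · intro h
        exact hz (h (Set.mem_singleton _))
    rw [hS] at hkerS
    obtain ⟨𝔯, h𝔯, h𝔯e⟩ := hkerS
    obtain ⟨M, hM, h𝔯M⟩ := Ideal.exists_le_maximal 𝔯.asIdeal 𝔯.isPrime.ne_top
    obtain ⟨x, rfl⟩ := eq_vanishingIdeal_singleton_of_isMaximal ℂ hM
    have hkx : ∀ D, e D = 0 → eval x (fiberCoordHom j D) = 0 := by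
      intro D hD
      have h1 : D ∈ (PrimeSpectrum.comap (fiberCoordHom j) 𝔯).asIdeal := by rw [h𝔯e]; exact hD
      have h2 := h𝔯M (show fiberCoordHom j D ∈ 𝔯.asIdeal from h1)
      rw [mem_vanishingIdeal_singleton_iff] at h2
      simpa [aeval_eq_eval] using h2
    have hxj : x (Sum.inr j) = z := by
      have := hkx (Polynomial.X - Polynomial.C (C z)) (by simp [he])
      simpa [fiberCoordHom, sub_eq_zero] using this
    have hxu : ∀ i, x (Sum.inl i) = u i := fun i => by
      have := hkx (Polynomial.C (X i - C (u i))) (by simp [he])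
      simpa [fiberCoordHom, sub_eq_zero] using this
    have hx : Sum.elim u (fun i => x (Sum.inr i)) = x := by
      ext (i | i) <;> simp [hxu]
    have := hB (fun i => x (Sum.inr i)) fun i => by
      rw [hx]
      have h2 := h𝔯M (h𝔯 (hI𝔮 (show ps i ∈ I from
        (le_sup_left : Ideal.span (Set.range ps) ≤ I) (Ideal.subset_span ⟨i, rfl⟩))))
      rw [mem_vanishingIdeal_singleton_iff] at h2
      simpa [aeval_eq_eval] using h2
    simp only [hxj] at this
    linarith
  · obtain ⟨_, hDI, ⟨D, hDP, rfl⟩⟩ := Set.not_disjoint_iff.1 hdis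
    refine ⟨D, ?_, fun u hu v hv => ?_⟩
    · by_contra! h
      exact hDP ((hmemP D).2 h)
    · rw [← eval_fiberCoordHom]
      have hle : I ≤ RingHom.ker (eval (Sum.elim u v)) := by
        rw [hI, sup_le_iff, Ideal.span_le, Ideal.map_le_iff_le_comap]
        refine ⟨?_, fun E hE => ?_⟩
        · rintro _ ⟨i, rfl⟩
          exact hv i
        · rw [Ideal.mem_comap, RingHom.mem_ker, eval_fiberCoordHom]
          exact hker u hu _ E hE
      exact hle hDI

end Algebra

section Separable

open Set

open MvPolynomial

/-- After inverting one element, the root set of a nonzero polynomial is contained in that of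
a separable polynomial. -/
theorem exists_generically_separable {B : Type*} [CommRing B] [IsDomain B] [CharZero B]
    {D : Polynomial B} (hD : D ≠ 0) :
    ∃ (F : Polynomial B) (b : B), b ≠ 0 ∧ ∀ {k : Type} [Field k] (φ : B →+* k), φ b ≠ 0 →
      ∀ z, D.eval₂ φ z = 0 → F.eval₂ φ z = 0 ∧ F.derivative.eval₂ φ z ≠ 0 := by
  classical
  set K := FractionRing B
  have : CharZero K := charZero_of_injective_algebraMap (IsFractionRing.injective B K)
  set ι := algebraMap B K
  have hι : Function.Injective (Polynomial.map ι) :=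
    Polynomial.map_injective ι (IsFractionRing.injective B K)
  have hDK : D.map ι ≠ 0 := fun h => hD (hι (by simpa using h))
  set F := UniqueFactorizationMonoid.radical (D.map ι)
  obtain ⟨a, c, hac⟩ : F.Separable :=
    PerfectField.separable_iff_squarefree.2 UniqueFactorizationMonoid.squarefree_radical
  obtain ⟨N, e, he⟩ := UniqueFactorizationMonoid.exists_dvd_radical_self_pow hDK
  have key : ∀ p : Polynomial K, ∃ (b : B) (q : Polynomial B), b ≠ 0 ∧
      q.map ι = Polynomial.C (ι b) * p := fun p => by
    obtain ⟨b, hb, h⟩ := IsLocalization.integerNormalization_spec (nonZeroDivisors B) p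
    refine ⟨b, _, nonZeroDivisors.ne_zero hb, h.trans ?_⟩
    rw [← Polynomial.smul_eq_C_mul, algebraMap_smul]
  obtain ⟨f, F₁, hf, hF₁⟩ := key F
  obtain ⟨α, a₁, hα, ha₁⟩ := key a
  obtain ⟨γ, c₁, hγ, hc₁⟩ := key c
  obtain ⟨ε, e₁, hε, he₁⟩ := key e
  have hbez : Polynomial.C γ * a₁ * F₁ + Polynomial.C α * c₁ * Polynomial.derivative F₁ =
      Polynomial.C (f * α * γ) := by
    apply hι
    simp only [Polynomial.map_add, Polynomial.map_mul, ← Polynomial.derivative_map, hF₁, ha₁, hc₁,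
      Polynomial.map_C, map_mul, Polynomial.derivative_C_mul]
    linear_combination (Polynomial.C (ι f) * Polynomial.C (ι α) * Polynomial.C (ι γ)) * hac
  have hpow : Polynomial.C ε * F₁ ^ N = Polynomial.C (f ^ N) * e₁ * D := by
    apply hι
    simp only [Polynomial.map_mul, Polynomial.map_pow, hF₁, he₁, Polynomial.map_C, map_pow, mul_pow]
    change _ * (_ * F ^ N) = _
    rw [he]
    ring
  refine ⟨F₁, f * α * γ * ε, by simp [*], fun φ hφ z hz => ?_⟩
  simp only [map_mul, mul_ne_zero_iff] at hφ
  have h1 := congrArg (Polynomial.eval₂ φ z) hpow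
  have h2 := congrArg (Polynomial.eval₂ φ z) hbez
  simp only [Polynomial.eval₂_mul, Polynomial.eval₂_add, Polynomial.eval₂_C, Polynomial.eval₂_pow,
    hz, mul_zero, map_mul] at h1 h2
  have h3 : F₁.eval₂ φ z = 0 :=
    eq_zero_of_pow_eq_zero ((mul_eq_zero.1 h1).resolve_left hφ.2)
  refine ⟨h3, fun h4 => ?_⟩
  rw [h3, h4, mul_zero, mul_zero, add_zero] at h2
  exact mul_ne_zero (mul_ne_zero hφ.1.1.1 hφ.1.1.2) hφ.1.2 h2.symm

/-- Over a general point of an irreducible subvariety of the base, each coordinate of the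
bounded fibres is a simple root of a fixed polynomial. -/
theorem exists_simple_root_polynomial {m s q : ℕ}
    (ps : Fin q → MvPolynomial (Fin m ⊕ Fin s) ℂ) (j : Fin s)
    (hb : ∀ u : Fin m → ℂ, ∃ B : ℝ, ∀ v : Fin s → ℂ,
      (∀ i, eval (Sum.elim u v) (ps i) = 0) → ‖v j‖ ≤ B)
    (p : Ideal (MvPolynomial (Fin m) ℂ)) [hp : p.IsPrime] :
    ∃ (F : Polynomial (MvPolynomial (Fin m) ℂ)) (b : MvPolynomial (Fin m) ℂ), b ∉ p ∧
      ∀ u : Fin m → ℂ, (∀ a ∈ p, eval u a = 0) → eval u b ≠ 0 → ∀ v : Fin s → ℂ,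
        (∀ i, eval (Sum.elim u v) (ps i) = 0) →
        pEval u (v j) F = 0 ∧ pEval u (v j) (Polynomial.derivative F) ≠ 0 := by
  obtain ⟨D, ⟨k, hk⟩, hD⟩ := exists_polynomial_of_bounded_fibers ps j hb p
  set π := Ideal.Quotient.mk p
  have : CharZero (MvPolynomial (Fin m) ℂ ⧸ p) := algebraRat.charZero _
  have hD0 : D.map π ≠ 0 := fun h => hk (by
    have := congrArg (fun r => Polynomial.coeff r k) h
    simpa [π, Ideal.Quotient.eq_zero_iff_mem] using this)
  obtain ⟨F, b, hb0, hF⟩ := exists_generically_separable hD0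
  obtain ⟨F, rfl⟩ := Polynomial.map_surjective π Ideal.Quotient.mk_surjective F
  obtain ⟨b, rfl⟩ := Ideal.Quotient.mk_surjective b
  refine ⟨F, b, fun h => hb0 (Ideal.Quotient.eq_zero_iff_mem.2 h), fun u hu hub v hv => ?_⟩
  set φ := Ideal.Quotient.lift p (eval u) hu
  have hφ : φ.comp π = eval u := RingHom.ext fun x => Ideal.Quotient.lift_mk p _ hu
  have := hF φ (by change (φ.comp π) b ≠ 0; rwa [hφ]) (v j) (by
    rw [Polynomial.eval₂_map, hφ]
    exact hD u hu v hv)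
  rwa [Polynomial.derivative_map, Polynomial.eval₂_map, Polynomial.eval₂_map, hφ] at this

/-- A prime ideal containing the equations of a variety with bounded fibres, whose quotient
contains `m` algebraically independent elements, meets the base coordinate ring trivially. -/
theorem rename_notMem_of_algebraicIndependent {m s q : ℕ}
    (ps : Fin q → MvPolynomial (Fin m ⊕ Fin s) ℂ)
    (hb : ∀ u : Fin m → ℂ, ∃ B : ℝ, ∀ v : Fin s → ℂ,
      (∀ i, eval (Sum.elim u v) (ps i) = 0) → ∀ j, ‖v j‖ ≤ B)
    (𝔭 : Ideal (MvPolynomial (Fin m ⊕ Fin s) ℂ)) [h𝔭 : 𝔭.IsPrime] (hps : ∀ i, ps i ∈ 𝔭)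
    (ℓ : Fin m → MvPolynomial (Fin m ⊕ Fin s) ℂ)
    (hℓ : AlgebraicIndependent ℂ fun i => Ideal.Quotient.mkₐ ℂ 𝔭 (ℓ i))
    {R : MvPolynomial (Fin m) ℂ} (hR : R ≠ 0) :
    rename Sum.inl R ∉ 𝔭 := by
  set π := Ideal.Quotient.mkₐ ℂ 𝔭 with hπ
  set x : Fin m → MvPolynomial (Fin m ⊕ Fin s) ℂ ⧸ 𝔭 := fun i => π (X (Sum.inl i)) with hx
  have hxaeval : ∀ a : MvPolynomial (Fin m) ℂ, aeval x a = π (rename Sum.inl a) := fun a => by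
    have : aeval x = π.comp (rename Sum.inl) := by
      ext i; simp [hx]
    rw [this]; rfl
  have hπ0 : ∀ a, π a = 0 ↔ a ∈ 𝔭 := fun a => Ideal.Quotient.eq_zero_iff_mem
  set S₀ := Algebra.adjoin ℂ (Set.range x)
  set p := 𝔭.comap (rename (R := ℂ) (Sum.inl : Fin m → Fin m ⊕ Fin s))
  have hp : p.IsPrime := Ideal.IsPrime.comap _
  have hv : ∀ j, IsAlgebraic S₀ (π (X (Sum.inr j))) := by
    intro j
    obtain ⟨D, ⟨k, hk⟩, hD⟩ := exists_polynomial_of_bounded_fibers ps j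
      (fun u => (hb u).imp fun B hB v hv => hB v hv j) p
    have hmem : fiberCoordHom j D ∈ 𝔭 := by
      rw [← IsPrime.vanishingIdeal_zeroLocus (K := ℂ) 𝔭, mem_vanishingIdeal_iff]
      intro y hy
      have hy' : ∀ a ∈ 𝔭, eval y a = 0 := fun a ha => by simpa [aeval_eq_eval] using hy a ha
      have hyy : y = Sum.elim (fun i => y (Sum.inl i)) (fun i => y (Sum.inr i)) := by
        ext (i | i) <;> rfl
      have := hD (fun i => y (Sum.inl i)) (fun a ha => by
        have := hy' _ ha
        rwa [eval_rename] at this) (fun i => y (Sum.inr i)) (fun i => by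
        rw [← hyy]; exact hy' _ (hps i))
      have he := eval_fiberCoordHom j D (fun i => y (Sum.inl i)) (fun i => y (Sum.inr i))
      rw [← hyy, this] at he
      simpa [aeval_eq_eval] using he
    have hran : ∀ a : MvPolynomial (Fin m) ℂ, aeval x a ∈ S₀ := fun a => by
      change _ ∈ Algebra.adjoin ℂ (Set.range x)
      rw [Algebra.adjoin_range_eq_range_aeval]
      exact ⟨a, rfl⟩
    set ψ : MvPolynomial (Fin m) ℂ →ₐ[ℂ] S₀ := (aeval x).codRestrict S₀ hran
    have hψ : ∀ a, ((ψ a : S₀) : MvPolynomial (Fin m ⊕ Fin s) ℂ ⧸ 𝔭) = π (rename Sum.inl a) :=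
      fun a => hxaeval a
    refine ⟨D.map ψ.toRingHom, fun h => hk ?_, ?_⟩
    · have h1 := congrArg (fun r => Polynomial.coeff r k) h
      simp only [Polynomial.coeff_map, Polynomial.coeff_zero] at h1
      have h2 := hψ (D.coeff k)
      rw [show ψ (D.coeff k) = 0 from h1] at h2
      exact (hπ0 _).1 h2.symm
    · rw [← (hπ0 _)] at hmem
      rw [Polynomial.aeval_def, Polynomial.eval₂_map, ← hmem]
      have : (algebraMap S₀ (MvPolynomial (Fin m ⊕ Fin s) ℂ ⧸ 𝔭)).comp ψ.toRingHom =
          π.toRingHom.comp (rename (R := ℂ) (Sum.inl : Fin m → Fin m ⊕ Fin s)).toRingHom :=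
        RingHom.ext hψ
      rw [this]
      exact (Polynomial.hom_eval₂ _ _ π.toRingHom _).symm
  have : Algebra.IsAlgebraic S₀ (MvPolynomial (Fin m ⊕ Fin s) ℂ ⧸ 𝔭) := by
    refine ⟨fun a => ?_⟩
    obtain ⟨a, rfl⟩ := Ideal.Quotient.mkₐ_surjective ℂ 𝔭 a
    induction a using MvPolynomial.induction_on with
    | C c =>
      have : π (C c) = algebraMap S₀ _ (algebraMap ℂ S₀ c) := rfl
      rw [← hπ, this]
      exact isAlgebraic_algebraMap _
    | add a b ha hb => rw [map_add]; exact ha.add hb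
    | mul_X a i ha =>
      rw [map_mul]
      refine ha.mul ?_
      rcases i with i | j
      · have : x i ∈ S₀ := Algebra.subset_adjoin ⟨i, rfl⟩
        exact isAlgebraic_algebraMap (⟨x i, this⟩ : S₀)
      · exact hv j
  have hbasis := Algebra.IsAlgebraic.isTranscendenceBasis_of_le_trdeg_of_finite ℂ x
    hℓ.cardinalMk_le_trdeg
  intro h
  refine hR (hbasis.1 (?_ : aeval x R = aeval x 0))
  rw [hxaeval, map_zero, hπ0]
  exact h

end Separable

section EvalHolomorphic

open Set

open MvPolynomial

theorem MvPolynomial.differentiable_eval {σ : Type*} [Fintype σ] (q : MvPolynomial σ ℂ) :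
    Differentiable ℂ fun u : σ → ℂ => eval u q := by
  induction q using MvPolynomial.induction_on with
  | C c => simp
  | add a b ha hb => simp only [map_add]; exact ha.add hb
  | mul_X a i ha => simp only [map_mul, eval_X]; exact ha.mul (differentiable_apply i)

theorem isPrime_vanishingIdeal_image {E : Type*} [NormedAddCommGroup E] [NormedSpace ℂ E]
    {σ : Type*} [Fintype σ] {U : Set E} (hU : IsOpen U) (hUc : IsPreconnected U)
    (hUne : U.Nonempty) {a : E → σ → ℂ} (ha : DifferentiableOn ℂ a U) :
    (vanishingIdeal ℂ (a '' U)).IsPrime := by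
  have hmem : ∀ q, q ∈ vanishingIdeal ℂ (a '' U) ↔ ∀ x ∈ U, eval (a x) q = 0 := fun q => by
    simp [aeval_eq_eval]
  have hd : ∀ q : MvPolynomial σ ℂ, DifferentiableOn ℂ (fun x => eval (a x) q) U := fun q =>
    (differentiable_eval q).comp_differentiableOn ha
  refine ⟨fun h => ?_, fun {p q} hpq => or_iff_not_imp_left.2 fun hp => ?_⟩
  · obtain ⟨x, hx⟩ := hUne
    simpa using (hmem 1).1 (h ▸ Submodule.mem_top) x hx
  · rw [hmem] at hp hpq ⊢
    push Not at hp
    intro x hx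
    refine tendsto_nhds_unique_of_frequently_eq
      ((hd q).continuousOn.continuousAt (hU.mem_nhds hx)) tendsto_const_nhds ?_
    refine ((frequently_ne_zero_of_isPreconnected hU hUc (hd p) hp hx).and_eventually
      (hU.eventually_mem hx)).mono fun y hy => ?_
    have := hpq y hy.2
    rw [map_mul] at this
    exact (mul_eq_zero.1 this).resolve_left hy.1

theorem exists_eval_sumElim_eq {m s : ℕ} (Λ : (Fin m → ℂ) × (Fin s → ℂ) →ₗ[ℂ] ℂ) :
    ∃ ℓ : MvPolynomial (Fin m ⊕ Fin s) ℂ, ∀ p, eval (Sum.elim p.1 p.2) ℓ = Λ p := by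
  refine ⟨∑ i, C (Λ (Pi.single i 1, 0)) * X (Sum.inl i) +
    ∑ j, C (Λ (0, Pi.single j 1)) * X (Sum.inr j), fun p => ?_⟩
  have h : p = ∑ i, p.1 i • ((Pi.single i 1, 0) : (Fin m → ℂ) × (Fin s → ℂ)) +
      ∑ j, p.2 j • ((0, Pi.single j 1) : (Fin m → ℂ) × (Fin s → ℂ)) := by
    ext i <;> simp [Prod.fst_sum, Prod.snd_sum, Finset.sum_apply, Pi.single_apply]
  conv_rhs => rw [h]
  simp only [map_add, map_sum, map_smul, smul_eq_mul, map_mul, eval_C, eval_X, Sum.elim_inl,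
    Sum.elim_inr, mul_comm]

theorem differentiable_sumElim {m s : ℕ} :
    Differentiable ℂ fun p : (Fin m → ℂ) × (Fin s → ℂ) => Sum.elim p.1 p.2 := by
  rw [differentiable_pi]
  rintro (i | j)
  · change Differentiable ℂ fun p : (Fin m → ℂ) × (Fin s → ℂ) => p.1 i
    fun_prop
  · change Differentiable ℂ fun p : (Fin m → ℂ) × (Fin s → ℂ) => p.2 j
    fun_prop

/-- On a variety of pure dimension `m` with bounded fibres over `ℂ^m`, the points over the
complement of a hypersurface are dense. -/
theorem mem_closure_eval_ne_zero {m s q : ℕ} (ps : Fin q → MvPolynomial (Fin m ⊕ Fin s) ℂ)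
    {V : Set ((Fin m → ℂ) × (Fin s → ℂ))}
    (hV : V = {p | ∀ i, eval (Sum.elim p.1 p.2) (ps i) = 0}) (hVdim : PureDim V m)
    (hb : ∀ u : Fin m → ℂ, ∃ B : ℝ, ∀ v : Fin s → ℂ,
      (∀ i, eval (Sum.elim u v) (ps i) = 0) → ∀ j, ‖v j‖ ≤ B)
    {R : MvPolynomial (Fin m) ℂ} (hR : R ≠ 0) {p : (Fin m → ℂ) × (Fin s → ℂ)} (hp : p ∈ V) :
    p ∈ closure {y | y ∈ V ∧ eval y.1 R ≠ 0} := by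
  refine closure_minimal ?_ isClosed_closure (hVdim.1 p hp)
  rintro y ⟨hyV, O, hO, hyO, e, Λ, Ω, γ, hΩ, hγ, hgraph⟩
  by_contra hcl
  set φ : (Fin m → ℂ) → (Fin m → ℂ) × (Fin s → ℂ) := fun w => Λ.symm (w, γ w) with hφ
  have hφV : ∀ w ∈ Ω, φ w ∈ V := fun w hw => by
    have : ((w, γ w) : (Fin m → ℂ) × (Fin e → ℂ)) ∈ Λ '' (V ∩ O) := by
      rw [hgraph]; exact ⟨hw, rfl⟩
    obtain ⟨z, hz, hzw⟩ := this
    rw [hφ]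
    simp only [← hzw, Λ.symm_apply_apply]
    exact hz.1
  have hy : Λ y ∈ {p : (Fin m → ℂ) × (Fin e → ℂ) | p.1 ∈ Ω ∧ p.2 = γ p.1} := by
    rw [← hgraph]; exact ⟨y, ⟨hyV, hyO⟩, rfl⟩
  have hφy : φ (Λ y).1 = y := by
    rw [hφ]
    simp only [← hy.2, Λ.symm_apply_apply]
  have hφd : DifferentiableOn ℂ φ Ω :=
    Λ.symm.differentiable.comp_differentiableOn (differentiableOn_id.prodMk hγ)
  have hnear : ∀ᶠ w in 𝓝 (Λ y).1, w ∈ Ω ∧ φ w ∉ closure {y | y ∈ V ∧ eval y.1 R ≠ 0} := by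
    refine (hΩ.eventually_mem hy.1).and ?_
    have hc : ContinuousAt φ (Λ y).1 := hφd.continuousOn.continuousAt (hΩ.mem_nhds hy.1)
    refine hc.tendsto.eventually (isClosed_closure.isOpen_compl.mem_nhds ?_)
    rwa [hφy]
  obtain ⟨ρ, hρ, hball⟩ := Metric.eventually_nhds_iff_ball.1 hnear
  set B := Metric.ball (Λ y).1 ρ
  set a : (Fin m → ℂ) → (Fin m ⊕ Fin s → ℂ) := fun w => Sum.elim (φ w).1 (φ w).2
  have ha : DifferentiableOn ℂ a B :=
    differentiable_sumElim.comp_differentiableOn (hφd.mono fun w hw => (hball w hw).1)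
  have hprime := isPrime_vanishingIdeal_image Metric.isOpen_ball
    (convex_ball (Λ y).1 ρ).isPreconnected ⟨_, Metric.mem_ball_self hρ⟩ ha
  have hmem : ∀ F, F ∈ vanishingIdeal ℂ (a '' B) ↔ ∀ w ∈ B, eval (a w) F = 0 := fun q => by
    simp [aeval_eq_eval]
  choose ℓ hℓ using fun i => exists_eval_sumElim_eq (m := m) (s := s)
    ((LinearMap.proj i).comp ((LinearMap.fst ℂ (Fin m → ℂ) (Fin e → ℂ)).comp Λ.toLinearMap))
  have hℓa : ∀ w i, eval (a w) (ℓ i) = w i := fun w i => by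
    simp [a, hℓ, φ]
  refine rename_notMem_of_algebraicIndependent ps hb (vanishingIdeal ℂ (a '' B)) ?_ ℓ ?_ hR ?_
  · intro i
    rw [hmem]
    intro w hw
    have := hφV w (hball w hw).1
    rw [hV] at this
    exact this i
  · rw [algebraicIndependent_iff]
    intro F hF
    have h1 : aeval ℓ F ∈ vanishingIdeal ℂ (a '' B) := by
      rw [← Ideal.Quotient.eq_zero_iff_mem, ← hF]
      exact comp_aeval_apply ℓ (Ideal.Quotient.mkₐ ℂ (vanishingIdeal ℂ (a '' B))) F
    rw [hmem] at h1
    refine funext_set (fun i => Metric.ball ((Λ y).1 i) ρ) (fun i => ?_) (fun w hw => ?_)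
    · exact infinite_of_mem_nhds _ (Metric.ball_mem_nhds _ hρ)
    · have hwB : w ∈ B := by
        rw [← ball_pi _ hρ] at hw
        exact hw
      have h2 := h1 w hwB
      rw [map_zero, ← h2]
      have h3 : (eval (a w)).comp (aeval ℓ).toRingHom = eval w := by
        ext i
        · simp
        · simp [hℓa]
      rw [← h3]; rfl
  · rw [hmem]
    intro w hw
    rw [eval_rename]
    by_contra h
    exact (hball w hw).2 (subset_closure ⟨hφV w (hball w hw).1, h⟩)

theorem finite_fiber {m s q : ℕ} (ps : Fin q → MvPolynomial (Fin m ⊕ Fin s) ℂ)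
    (hb : ∀ u : Fin m → ℂ, ∃ B : ℝ, ∀ v : Fin s → ℂ,
      (∀ i, eval (Sum.elim u v) (ps i) = 0) → ∀ j, ‖v j‖ ≤ B) (u : Fin m → ℂ) :
    {v : Fin s → ℂ | ∀ i, eval (Sum.elim u v) (ps i) = 0}.Finite := by
  have hp : (RingHom.ker (eval u)).IsPrime := RingHom.ker_isPrime _
  choose D hD0 hD using fun j => exists_polynomial_of_bounded_fibers ps j
    (fun u => (hb u).imp fun B hB v hv => hB v hv j) (RingHom.ker (eval u))
  refine (Set.Finite.pi' (fun j => (((D j).map (eval u)).roots.toFinset : Set ℂ).toFinite)).subset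
    fun v hv j => ?_
  obtain ⟨k, hk⟩ := hD0 j
  have h0 : (D j).map (eval u) ≠ 0 := fun h => hk (by
    have := congrArg (fun r => Polynomial.coeff r k) h
    simpa using this)
  rw [Finset.mem_coe, Multiset.mem_toFinset, Polynomial.mem_roots h0, Polynomial.IsRoot,
    Polynomial.eval_map]
  exact hD j u (fun a ha => ha) v hv

end EvalHolomorphic

section Slope

open Set

open MvPolynomial

variable {m : ℕ}

/-- The divided difference of `pEval u · F` at the points `z` and `w`. -/
noncomputable def pSlope (u : Fin m → ℂ) (z w : ℂ) (F : Polynomial (MvPolynomial (Fin m) ℂ)) : ℂ :=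
  ∑ k ∈ Finset.range (F.natDegree + 1),
    eval u (F.coeff k) * ∑ i ∈ Finset.range k, z ^ i * w ^ (k - 1 - i)

theorem pEval_eq_sum (u : Fin m → ℂ) (z : ℂ) (F : Polynomial (MvPolynomial (Fin m) ℂ)) :
    pEval u z F = ∑ k ∈ Finset.range (F.natDegree + 1), eval u (F.coeff k) * z ^ k :=
  Polynomial.eval₂_eq_sum_range (eval u) z

theorem pSlope_mul (u : Fin m → ℂ) (z w : ℂ) (F : Polynomial (MvPolynomial (Fin m) ℂ)) :
    pSlope u z w F * (z - w) = pEval u z F - pEval u w F := by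
  simp only [pSlope, pEval_eq_sum, Finset.sum_mul, ← Finset.sum_sub_distrib]
  refine Finset.sum_congr rfl fun k _ => ?_
  rw [← mul_sub, mul_assoc, ← geom_sum₂_mul]

theorem pSlope_self (u : Fin m → ℂ) (z : ℂ) (F : Polynomial (MvPolynomial (Fin m) ℂ)) :
    pSlope u z z F = pEval u z (Polynomial.derivative F) := by
  conv_rhs => rw [F.as_sum_range]
  simp only [pSlope, pEval, Polynomial.derivative_sum, Polynomial.eval₂_finsetSum,
    Polynomial.derivative_monomial, Polynomial.eval₂_monomial, map_mul, map_natCast,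
    geom_sum₂_self, mul_assoc]

theorem continuous_pSlope (F : Polynomial (MvPolynomial (Fin m) ℂ)) :
    Continuous fun y : (Fin m → ℂ) × ℂ × ℂ => pSlope y.1 y.2.1 y.2.2 F := by
  have h : ∀ k, Continuous fun y : (Fin m → ℂ) × ℂ × ℂ => eval y.1 (F.coeff k) := fun k =>
    (differentiable_eval _).continuous.comp continuous_fst
  exact continuous_finsetSum _ fun k _ => (h k).mul <| continuous_finsetSum _ fun i _ => by
    fun_prop

theorem differentiable_pEval_left (F : Polynomial (MvPolynomial (Fin m) ℂ)) (z : ℂ) :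
    Differentiable ℂ fun u : Fin m → ℂ => pEval u z F := by
  simp only [pEval_eq_sum]
  refine Differentiable.fun_sum fun k _ => ?_
  exact (differentiable_eval _).mul_const _

theorem DifferentiableAt.mul_continuousAt_of_eq_zero {E : Type*} [NormedAddCommGroup E]
    [NormedSpace ℂ E] {N k : E → ℂ} {x : E} (hN : DifferentiableAt ℂ N x) (h0 : N x = 0)
    (hk : ContinuousAt k x) : DifferentiableAt ℂ (fun y => N y * k y) x := by
  refine ⟨k x • fderiv ℂ N x, HasFDerivAt.of_isLittleO ?_⟩
  have h1 := hN.hasFDerivAt.isLittleO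
  have h2 : (fun y => N y - N x) =O[𝓝 x] fun y => y - x := hN.hasFDerivAt.isBigO_sub
  have h3 : (fun y => k y - k x) =o[𝓝 x] fun _ => (1 : ℝ) := by
    rw [Asymptotics.isLittleO_one_iff]
    simpa using Tendsto.sub_const hk (k x)
  have h4 : (fun y => (N y - N x) * (k y - k x)) =o[𝓝 x] fun y => y - x := by
    have := (h2.norm_right).mul_isLittleO h3
    simpa using this
  have h5 := (h1.const_mul_left (k x)).add h4
  refine h5.congr_left fun y => ?_
  simp [h0]
  ring

theorem differentiableAt_of_simple_root {E : Type*} [NormedAddCommGroup E] [NormedSpace ℂ E]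
    {a : E → Fin m → ℂ} {g : E → ℂ} {x : E} (ha : DifferentiableAt ℂ a x) (hg : ContinuousAt g x)
    {F : Polynomial (MvPolynomial (Fin m) ℂ)} (h0 : ∀ᶠ y in 𝓝 x, pEval (a y) (g y) F = 0)
    (h1 : pEval (a x) (g x) (Polynomial.derivative F) ≠ 0) : DifferentiableAt ℂ g x := by
  have hs : ContinuousAt (fun y => pSlope (a y) (g y) (g x) F) x :=
    ContinuousAt.comp (f := fun y => (a y, g y, g x))
      (g := fun y : (Fin m → ℂ) × ℂ × ℂ => pSlope y.1 y.2.1 y.2.2 F) (continuous_pSlope F).continuousAt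
      (ha.continuousAt.prodMk (hg.prodMk continuousAt_const))
  rw [← pSlope_self] at h1
  have hN : DifferentiableAt ℂ (fun y => pEval (a y) (g x) F) x :=
    (differentiable_pEval_left F (g x)).differentiableAt.comp x ha
  have hd := (hN.mul_continuousAt_of_eq_zero h0.self_of_nhds (hs.inv₀ h1)).const_sub (g x)
  refine hd.congr_of_eventuallyEq ?_
  filter_upwards [h0, hs.eventually_ne h1] with y hy hy1
  have := pSlope_mul (a y) (g y) (g x) F
  rw [hy] at this
  rw [Pi.inv_apply]
  field_simp
  linear_combination this

theorem exists_root_near {F : Polynomial (MvPolynomial (Fin m) ℂ)} (hF : F.Monic)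
    {u : Fin m → ℂ} {t : ℂ} (h0 : pEval u t F = 0) {ε : ℝ} (hε : 0 < ε) :
    ∀ᶠ y in 𝓝 u, ∃ r ∈ Metric.ball t ε, pEval y r F = 0 := by
  have hc : ContinuousAt (fun y => pEval y t F) u :=
    (differentiable_pEval_left F t).continuous.continuousAt
  have := hc.norm.eventually_lt (continuousAt_const (y := ε ^ F.natDegree))
    (by simp only [h0, norm_zero]; positivity)
  filter_upwards [this] with y hy
  by_contra! hr
  refine hy.not_ge ?_
  have hm : (F.map (eval y)).Monic := hF.map _
  have hsp : (F.map (eval y)).Splits := IsAlgClosed.splits _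
  have he : ∀ z, pEval y z F = (F.map (eval y)).eval z := fun z =>
    Polynomial.eval₂_eq_eval_map _
  rw [he, hsp.eval_eq_prod_roots_of_monic hm, ← hF.natDegree_map (eval y),
    hsp.natDegree_eq_card_roots]
  have hroots : ∀ r ∈ (F.map (eval y)).roots, ε ≤ ‖t - r‖ := fun r hmem => by
    by_contra! h
    refine hr r (by rwa [Metric.mem_ball, dist_comm, dist_eq_norm]) ?_
    rw [he]
    exact Polynomial.isRoot_of_mem_roots hmem
  generalize (F.map (eval y)).roots = S at hroots
  induction S using Multiset.induction_on with
  | empty => simp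
  | cons r S ih =>
    simp only [Multiset.map_cons, Multiset.prod_cons, norm_mul, Multiset.card_cons, pow_succ']
    exact mul_le_mul (hroots r (by simp)) (ih fun r' hr' => hroots r' (by simp [hr']))
      (by positivity) (norm_nonneg _)

end Slope

section Proper

open Set

variable {X Y ι : Type} [MetricSpace X] [ProperSpace X] [TopologicalSpace Y]

theorem MapClusterPt.eq_of_tendsto {Z ι : Type*} [TopologicalSpace Z] [T2Space Z] {l : Filter ι}
    {a : ι → Z} {x y : Z} (h : MapClusterPt x l a) (ha : Tendsto a l (𝓝 y)) : x = y := by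
  have : (𝓝 x ⊓ 𝓝 y).NeBot := ClusterPt.mono h ha
  exact eq_of_nhds_neBot this

theorem ProperProjOn.exists_mapClusterPt {V : Set (X × Y)} (hV : ProperProjOn univ V)
    {C : Set Y} (hC : IsClosed C) {l : Filter ι} {a : ι → X} {b : ι → Y} {u : X}
    (hab : ∀ᶠ i in l, (a i, b i) ∈ V) (ha : Tendsto a l (𝓝 u)) (hb : ∃ᶠ i in l, b i ∈ C) :
    ∃ v ∈ C, (u, v) ∈ V ∧ MapClusterPt v l b := by
  have hK := (hV (Metric.closedBall u 1) (subset_univ _) (isCompact_closedBall u 1)).inter_right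
    (hC.preimage continuous_snd)
  have hmem := ha.eventually (Metric.closedBall_mem_nhds u one_pos)
  obtain ⟨⟨u', v⟩, ⟨⟨h1, -⟩, h2⟩, h3⟩ := hK.exists_mapClusterPt_of_frequently
    (f := fun i => (a i, b i)) (l := l)
    ((hb.and_eventually (hab.and hmem)).mono fun i hi => ⟨⟨hi.2.1, hi.2.2⟩, hi.1⟩)
  have hu : u' = u := (h3.continuousAt_comp continuous_fst.continuousAt).eq_of_tendsto ha
  subst hu
  exact ⟨v, h2, h1, h3.continuousAt_comp continuous_snd.continuousAt⟩

theorem ProperProjOn.tendsto_of_unique {V : Set (X × Y)} (hV : ProperProjOn univ V)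
    {l : Filter ι} {a : ι → X} {b : ι → Y} {u : X} {v : Y}
    (hab : ∀ᶠ i in l, (a i, b i) ∈ V) (ha : Tendsto a l (𝓝 u))
    (huniq : ∀ w, (u, w) ∈ V → MapClusterPt w l b → w = v) : Tendsto b l (𝓝 v) := by
  by_contra h
  obtain ⟨O, hO, hOv, hf⟩ : ∃ O, IsOpen O ∧ v ∈ O ∧ ∃ᶠ i in l, b i ∈ Oᶜ := by
    by_contra! hcon
    refine h (tendsto_nhds.2 fun O hO hv => ?_)
    exact (hcon O hO hv).mono fun i hi => not_not.1 hi
  obtain ⟨w, hw, hwV, hwc⟩ := hV.exists_mapClusterPt hO.isClosed_compl hab ha hf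
  exact hw (huniq w hwV hwc ▸ hOv)

end Proper

section FiberInjective

open Set

open MvPolynomial

/-- If `P` describes the image of `V` under `L` and `L` separates the points of the generic fibres
of `V`, then `L` separates the points of every fibre over which `P` has only simple roots. -/
theorem injOn_fiber_of_simple_roots {m s q : ℕ} (ps : Fin q → MvPolynomial (Fin m ⊕ Fin s) ℂ)
    {V : Set ((Fin m → ℂ) × (Fin s → ℂ))}
    (hV : V = {p | ∀ i, eval (Sum.elim p.1 p.2) (ps i) = 0}) (hVdim : PureDim V m)
    (hVprop : ProperProjOn univ V)
    (hb : ∀ u : Fin m → ℂ, ∃ B : ℝ, ∀ v : Fin s → ℂ,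
      (∀ i, eval (Sum.elim u v) (ps i) = 0) → ∀ j, ‖v j‖ ≤ B)
    {L : (Fin s → ℂ) →ₗ[ℂ] ℂ} {R₀ : MvPolynomial (Fin m) ℂ} (hR₀ : R₀ ≠ 0)
    (hgen : ∀ u, eval u R₀ ≠ 0 → InjOn L {v | (u, v) ∈ V})
    {P : Polynomial (MvPolynomial (Fin m) ℂ)} (hP : P.Monic)
    (hdesc : ∀ u t, pEval u t P = 0 ↔ ∃ v, (u, v) ∈ V ∧ L v = t) {u₀ : Fin m → ℂ}
    (hsimple : ∀ z, pEval u₀ z P = 0 → pEval u₀ z (Polynomial.derivative P) ≠ 0) :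
    InjOn L {v | (u₀, v) ∈ V} := by
  intro v hv v' hv' hLL
  by_contra hne
  have hLc : Continuous L := L.continuous_of_finiteDimensional
  obtain ⟨ε, hε, hεs⟩ : ∃ ε > 0, ∀ y ∈ Metric.ball (u₀, L v, L v) ε,
      pSlope y.1 y.2.1 y.2.2 P ≠ 0 := by
    refine Metric.eventually_nhds_iff_ball.1
      ((continuous_pSlope P).continuousAt.eventually_ne ?_)
    rw [pSlope_self]
    exact hsimple _ ((hdesc _ _).2 ⟨v, hv, rfl⟩)
  have huniq : ∀ u ∈ Metric.ball u₀ ε, ∀ v₁ v₂, (u, v₁) ∈ V → (u, v₂) ∈ V →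
      L v₁ ∈ Metric.ball (L v) ε → L v₂ ∈ Metric.ball (L v) ε → L v₁ = L v₂ := by
    intro u hu v₁ v₂ h₁ h₂ hb₁ hb₂
    have hsl := hεs (u, L v₁, L v₂) (by
      simp only [Metric.mem_ball, Prod.dist_eq, max_lt_iff] at hu hb₁ hb₂ ⊢
      exact ⟨hu, hb₁, hb₂⟩)
    have := pSlope_mul u (L v₁) (L v₂) P
    rw [(hdesc _ _).2 ⟨v₁, h₁, rfl⟩, (hdesc _ _).2 ⟨v₂, h₂, rfl⟩, sub_zero] at this
    exact sub_eq_zero.1 ((mul_eq_zero.1 this).resolve_left hsl)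
  have hchoice : ∀ u, ∃ w : Fin s → ℂ, (∃ w', (u, w') ∈ V ∧ L w' ∈ Metric.ball (L v) (ε / 2)) →
      (u, w) ∈ V ∧ L w ∈ Metric.ball (L v) (ε / 2) := fun u => by
    by_cases h : ∃ w', (u, w') ∈ V ∧ L w' ∈ Metric.ball (L v) (ε / 2)
    · exact h.imp fun w hw _ => hw
    · exact ⟨0, fun h' => (h h').elim⟩
  choose w hw using hchoice
  have hwV : ∀ᶠ u in 𝓝 u₀, (u, w u) ∈ V ∧ L (w u) ∈ Metric.ball (L v) (ε / 2) := by
    filter_upwards [exists_root_near hP ((hdesc _ _).2 ⟨v, hv, rfl⟩) (half_pos hε)] with u hu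
    obtain ⟨r, hr, hru⟩ := hu
    obtain ⟨w', hw', rfl⟩ := (hdesc _ _).1 hru
    exact hw u ⟨w', hw', hr⟩
  have hfin : {v | (u₀, v) ∈ V}.Finite := by
    have := finite_fiber ps hb u₀
    rwa [hV]
  obtain ⟨η, hη, hηS⟩ : ∃ η > 0, Metric.closedBall v η ⊆ ({v | (u₀, v) ∈ V} \ {v})ᶜ :=
    Metric.nhds_basis_closedBall.mem_iff.1
      ((hfin.subset sdiff_subset).isClosed.isOpen_compl.mem_nhds (by simp))
  have hsph : ∀ᶠ u in 𝓝 u₀, w u ∉ Metric.sphere v η := by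
    by_contra hcon
    obtain ⟨v₁, h₁, h₂, -⟩ := hVprop.exists_mapClusterPt (C := Metric.sphere v η)
      Metric.isClosed_sphere (hwV.mono fun u hu => hu.1) tendsto_id
      ((not_eventually.1 hcon).mono fun u hu => not_not.1 hu)
    refine hηS (Metric.sphere_subset_closedBall h₁) ⟨h₂, ?_⟩
    rintro rfl
    exact hη.ne' (by simpa using h₁.symm)
  obtain ⟨ρ, hρ, hρε, hball⟩ : ∃ ρ > 0, ρ ≤ ε ∧ ∀ u ∈ Metric.ball u₀ ρ,
      ((u, w u) ∈ V ∧ L (w u) ∈ Metric.ball (L v) (ε / 2)) ∧ w u ∉ Metric.sphere v η := by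
    obtain ⟨ρ, hρ, h⟩ := Metric.eventually_nhds_iff_ball.1 (hwV.and hsph)
    exact ⟨min ρ ε, lt_min hρ hε, min_le_right _ _,
      fun u hu => h u (Metric.ball_subset_ball (min_le_left _ _) hu)⟩
  have hhalf : Metric.closedBall (L v) (ε / 2) ⊆ Metric.ball (L v) ε :=
    Metric.closedBall_subset_ball (half_lt_self hε)
  have hwuniq : ∀ u ∈ Metric.ball u₀ ρ, eval u R₀ ≠ 0 → ∀ v₁, (u, v₁) ∈ V →
      L v₁ ∈ Metric.closedBall (L v) (ε / 2) → v₁ = w u := fun u hu hu0 v₁ h₁ h₂ =>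
    hgen u hu0 h₁ (hball u hu).1.1 <| huniq u (Metric.ball_subset_ball hρε hu) _ _ h₁
      (hball u hu).1.1 (hhalf h₂) (hhalf (Metric.ball_subset_closedBall (hball u hu).1.2))
  have hcont : ContinuousOn w (Metric.ball u₀ ρ ∩ {u | eval u R₀ ≠ 0}) := by
    rintro u ⟨hu, hu0⟩
    refine ContinuousAt.continuousWithinAt ?_
    have hev := Metric.isOpen_ball.mem_nhds hu
    refine hVprop.tendsto_of_unique (a := id) ?_ tendsto_id fun v₁ h₁ h₂ =>
      hwuniq u hu hu0 v₁ h₁ ?_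
    · filter_upwards [hev] with y hy using (hball y hy).1.1
    · refine Metric.isClosed_closedBall.mem_of_mapClusterPt
        (h₂.continuousAt_comp hLc.continuousAt) ?_
      filter_upwards [hev] with y hy using Metric.ball_subset_closedBall (hball y hy).1.2
  have hnear : ∀ v₁, (u₀, v₁) ∈ V → L v₁ = L v → ∀ O ∈ 𝓝 v₁,
      ∃ u ∈ Metric.ball u₀ ρ ∩ {u | eval u R₀ ≠ 0}, w u ∈ O := by
    intro v₁ h₁ hL₁ O hO
    have hcl := mem_closure_iff_nhds.1 (mem_closure_eval_ne_zero ps hV hVdim hb hR₀ h₁)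
    obtain ⟨⟨u, v₂⟩, ⟨hu, hv₂, hv₂'⟩, hy, hy0⟩ := hcl
      (Metric.ball u₀ ρ ×ˢ (O ∩ L ⁻¹' Metric.closedBall (L v) (ε / 2)))
      (prod_mem_nhds (Metric.ball_mem_nhds _ hρ) (inter_mem hO (hLc.continuousAt.preimage_mem_nhds
        (by rw [hL₁]; exact Metric.closedBall_mem_nhds _ (half_pos hε)))))
    exact ⟨u, ⟨hu, hy0⟩, hwuniq u hu hy0 v₂ hy hv₂' ▸ hv₂⟩
  obtain ⟨u₁, hu₁, hw₁⟩ := hnear v hv rfl _ (Metric.closedBall_mem_nhds v hη)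
  obtain ⟨u₂, hu₂, hw₂⟩ := hnear v' hv' hLL.symm (Metric.closedBall v η)ᶜ
    (Metric.isClosed_closedBall.isOpen_compl.mem_nhds fun h =>
      hηS h ⟨hv', fun h => hne h.symm⟩)
  have hpre : IsPreconnected (Metric.ball u₀ ρ ∩ {u | eval u R₀ ≠ 0}) :=
    isPreconnected_inter_ne_zero Metric.isOpen_ball (convex_ball u₀ ρ).isPreconnected
      (differentiable_eval R₀).differentiableOn ⟨u₁, hu₁⟩
  obtain ⟨u, hu, huη⟩ := hpre.intermediate_value hu₁ hu₂
    ((continuous_id.dist (continuous_const (y := v))).comp_continuousOn hcont)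
    ⟨Metric.mem_closedBall.1 hw₁, (not_le.1 fun h => hw₂ (Metric.mem_closedBall.2 h)).le⟩
  exact (hball u hu.1).2 huη

end FiberInjective

section Lift

open Set

open MvPolynomial

theorem isClosed_zeroLocus_sumElim {m s q : ℕ} (ps : Fin q → MvPolynomial (Fin m ⊕ Fin s) ℂ) :
    IsClosed {p : (Fin m → ℂ) × (Fin s → ℂ) | ∀ i, eval (Sum.elim p.1 p.2) (ps i) = 0} := by
  simp only [ofPred_forall]
  exact isClosed_iInter fun i => isClosed_eq
    ((differentiable_eval (ps i)).continuous.comp differentiable_sumElim.continuous)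
    continuous_const

/-- A holomorphic map into the image of `V` under `L` lifts to a holomorphic map into `V`, if `L`
is injective on the generic fibres met by it. -/
theorem exists_differentiableOn_lift {E : Type} [NormedAddCommGroup E] [NormedSpace ℂ E]
    [FiniteDimensional ℂ E] {U : Set E} (hU : IsOpen U) (hUc : IsPreconnected U)
    {m s q : ℕ} (ps : Fin q → MvPolynomial (Fin m ⊕ Fin s) ℂ)
    {V : Set ((Fin m → ℂ) × (Fin s → ℂ))}
    (hV : V = {p | ∀ i, eval (Sum.elim p.1 p.2) (ps i) = 0}) (hVprop : ProperProjOn univ V)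
    (hb : ∀ u : Fin m → ℂ, ∃ B : ℝ, ∀ v : Fin s → ℂ,
      (∀ i, eval (Sum.elim u v) (ps i) = 0) → ∀ j, ‖v j‖ ≤ B)
    {L : (Fin s → ℂ) →ₗ[ℂ] ℂ} {R : MvPolynomial (Fin m) ℂ}
    (hinj : ∀ u, eval u R ≠ 0 → InjOn L {v | (u, v) ∈ V})
    {a : E → Fin m → ℂ} {t : E → ℂ} (ha : DifferentiableOn ℂ a U) (ht : DifferentiableOn ℂ t U)
    (hlift : ∀ x ∈ U, ∃ v, (a x, v) ∈ V ∧ L v = t x) (hR : ∃ x ∈ U, eval (a x) R ≠ 0) :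
    ∃ G : E → Fin s → ℂ, DifferentiableOn ℂ G U ∧ ∀ x ∈ U, (a x, G x) ∈ V ∧ L (G x) = t x := by
  have hLc : Continuous L := L.continuous_of_finiteDimensional
  have hVcl : IsClosed V := hV ▸ isClosed_zeroLocus_sumElim ps
  have hchoice : ∀ x, ∃ v, x ∈ U → (a x, v) ∈ V ∧ L v = t x := fun x => by
    by_cases hx : x ∈ U
    · exact (hlift x hx).imp fun v hv _ => hv
    · exact ⟨0, fun h => (hx h).elim⟩
  choose g hg using hchoice
  have haq : ∀ r : MvPolynomial (Fin m) ℂ, DifferentiableOn ℂ (fun x => eval (a x) r) U :=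
    fun r => (differentiable_eval r).comp_differentiableOn ha
  have hac : ∀ x ∈ U, ContinuousAt a x := fun x hx => ha.continuousOn.continuousAt (hU.mem_nhds hx)
  have hgc : ∀ x ∈ U, eval (a x) R ≠ 0 → ContinuousAt g x := by
    intro x hx hxR
    refine hVprop.tendsto_of_unique (a := a) ?_ (hac x hx) fun v hv hvc => ?_
    · filter_upwards [hU.mem_nhds hx] with y hy using (hg y hy).1
    · refine hinj _ hxR hv (hg x hx).1 ?_
      rw [(hg x hx).2]
      refine (hvc.continuousAt_comp hLc.continuousAt).eq_of_tendsto ?_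
      refine (ht.continuousOn.continuousAt (hU.mem_nhds hx)).congr' ?_
      filter_upwards [hU.mem_nhds hx] with y hy using (hg y hy).2.symm
  have hp : (vanishingIdeal ℂ (a '' U)).IsPrime :=
    isPrime_vanishingIdeal_image hU hUc (hR.imp fun x hx => hx.1) ha
  have hmem : ∀ r, r ∈ vanishingIdeal ℂ (a '' U) ↔ ∀ x ∈ U, eval (a x) r = 0 := fun r => by
    simp [aeval_eq_eval]
  choose F b hbp hF using fun j => exists_simple_root_polynomial ps j
    (fun u => (hb u).imp fun B hB v hv => hB v hv j) (vanishingIdeal ℂ (a '' U))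
  set r : MvPolynomial (Fin m) ℂ := R * ∏ j, b j with hr
  have hrp : r ∉ vanishingIdeal ℂ (a '' U) := by
    rw [hr, hp.mul_mem_iff_mem_or_mem, hp.prod_mem_iff]
    rintro (h | ⟨j, -, h⟩)
    · obtain ⟨x, hx, hxR⟩ := hR
      exact hxR ((hmem R).1 h x hx)
    · exact hbp j h
  have hrne : ∃ x ∈ U, eval (a x) r ≠ 0 := by
    by_contra! h
    exact hrp ((hmem r).2 h)
  have hgd : DifferentiableOn ℂ g (U ∩ {x | eval (a x) r ≠ 0}) := by
    rintro x ⟨hx, hxr⟩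
    rw [mem_ofPred_eq, hr, map_mul, map_prod, mul_ne_zero_iff, Finset.prod_ne_zero_iff] at hxr
    refine DifferentiableAt.differentiableWithinAt (differentiableAt_pi.2 fun j => ?_)
    have hroot : ∀ y ∈ U, eval (a y) (b j) ≠ 0 → pEval (a y) (g y j) (F j) = 0 ∧
        pEval (a y) (g y j) (Polynomial.derivative (F j)) ≠ 0 := fun y hy hyb =>
      hF j (a y) (fun c hc => (hmem c).1 hc y hy) hyb (g y) (by
        have := (hg y hy).1
        rwa [hV] at this)
    have hbj := hxr.2 j (Finset.mem_univ j)
    refine differentiableAt_of_simple_root (ha.differentiableAt (hU.mem_nhds hx))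
      (continuousAt_pi.1 (hgc x hx hxr.1) j) ?_ (hroot x hx hbj).2
    filter_upwards [hU.mem_nhds hx, ((haq (b j)).continuousOn.continuousAt
      (hU.mem_nhds hx)).eventually_ne hbj] with y hy hyb using (hroot y hy hyb).1
  have hbd : ∀ x ∈ U, ∃ C : ℝ, ∀ᶠ y in 𝓝 x, eval (a y) r ≠ 0 → ‖g y‖ ≤ C := by
    intro x hx
    obtain ⟨C, hC⟩ := (hVprop (Metric.closedBall (a x) 1) (subset_univ _)
      (isCompact_closedBall _ _)).isBounded.exists_norm_le
    refine ⟨C, ?_⟩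
    filter_upwards [hU.mem_nhds hx, (hac x hx).eventually
      (Metric.closedBall_mem_nhds (a x) one_pos)] with y hy hya _
    exact (norm_snd_le (a y, g y)).trans (hC _ ⟨(hg y hy).1, hya⟩)
  obtain ⟨G, hG, hGg⟩ := exists_differentiableOn_extension hU hUc (haq r) hrne hgd hbd
  refine ⟨G, hG, fun x hx => ?_⟩
  have hcl : IsClosed {y : ((Fin m → ℂ) × (Fin s → ℂ)) × ℂ | y.1 ∈ V ∧ L y.1.2 = y.2} :=
    (hVcl.preimage continuous_fst).inter
      (isClosed_eq (hLc.comp (continuous_snd.comp continuous_fst)) continuous_snd)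
  have hfreq : ∃ᶠ y in 𝓝 x, ((a y, G y), t y) ∈
      {y : ((Fin m → ℂ) × (Fin s → ℂ)) × ℂ | y.1 ∈ V ∧ L y.1.2 = y.2} := by
    refine ((frequently_ne_zero_of_isPreconnected hU hUc (haq r) hrne hx).and_eventually
      (hU.mem_nhds hx)).mono fun y hy => ?_
    rw [mem_ofPred_eq, hGg y hy.2 hy.1]
    exact hg y hy.2
  exact hcl.mem_of_frequently_of_tendsto hfreq
    (((hac x hx).prodMk (hG.continuousOn.continuousAt (hU.mem_nhds hx))).prodMk
      (ht.continuousOn.continuousAt (hU.mem_nhds hx)))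

end Lift

theorem stmt_3 (n m s : ℕ) (U : Set (Fin n → ℂ)) (hU : IsOpen U) (hUc : IsConnected U)
    (V : Set ((Fin m → ℂ) × (Fin s → ℂ)))
    (hValg : ∃ (q : ℕ) (ps : Fin q → MvPolynomial ((Fin m) ⊕ (Fin s)) ℂ),
      V = {p | ∀ i, MvPolynomial.eval (Sum.elim p.1 p.2) (ps i) = 0})
    (hVdim : PureDim V m)
    (hVprop : ProperProjOn (Set.univ : Set (Fin m → ℂ)) V)
    (L : (Fin s → ℂ) →ₗ[ℂ] ℂ)
    -- the generic fibers of V and Φ_L(V) over ℂ^m have the same cardinality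
    (hLgen : ∃ R₀ : MvPolynomial (Fin m) ℂ, R₀ ≠ 0 ∧ ∀ u : Fin m → ℂ,
      MvPolynomial.eval u R₀ ≠ 0 →
        Set.ncard {v : Fin s → ℂ | (u, v) ∈ V} =
        Set.ncard {t : ℂ | (u, t) ∈
          (fun p : (Fin m → ℂ) × (Fin s → ℂ) => (p.1, L p.2)) '' V})
    -- P_L is the optimal (unitary) polynomial describing the hypersurface Φ_L(V)
    (P : Polynomial (MvPolynomial (Fin m) ℂ)) (hPmonic : P.Monic)
    (hPdesc : (fun p : (Fin m → ℂ) × (Fin s → ℂ) => (p.1, L p.2)) '' V =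
      {p : (Fin m → ℂ) × ℂ | pEval p.1 p.2 P = 0})
    -- R_L is the discriminant of P_L: it vanishes exactly where P_L has a multiple root
    (R : MvPolynomial (Fin m) ℂ)
    (hRdisc : ∀ u : Fin m → ℂ, MvPolynomial.eval u R = 0 ↔
      ∃ z : ℂ, pEval u z P = 0 ∧ pEval u z (Polynomial.derivative P) = 0)
    -- the holomorphic solution (f, g) : U → V
    (f : (Fin n → ℂ) → (Fin m → ℂ)) (g : (Fin n → ℂ) → (Fin s → ℂ))
    (hf : DifferentiableOn ℂ f U) (hg : DifferentiableOn ℂ g U)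
    (hfgV : ∀ x ∈ U, (f x, g x) ∈ V)
    (hRf : ∃ x ∈ U, MvPolynomial.eval (f x) R ≠ 0)
    -- the approximating sequences
    (fν : ℕ → (Fin n → ℂ) → (Fin m → ℂ)) (tν : ℕ → (Fin n → ℂ) → ℂ)
    (hfν : ∀ ν, DifferentiableOn ℂ (fν ν) U)
    (htν : ∀ ν, DifferentiableOn ℂ (tν ν) U)
    (hfνconv : TendstoLocallyUniformlyOn fν f atTop U)
    (htνconv : TendstoLocallyUniformlyOn tν (fun x => L (g x)) atTop U)
    (hPν : ∀ ν, ∀ x ∈ U, pEval (fν ν x) (tν ν x) P = 0) :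
    ∃ gν : ℕ → (Fin n → ℂ) → (Fin s → ℂ),
      (∀ ν, DifferentiableOn ℂ (gν ν) U) ∧
      TendstoLocallyUniformlyOn gν g atTop U ∧
      ∀ᶠ ν in atTop, ∀ x ∈ U, (fν ν x, gν ν x) ∈ V := by
  obtain ⟨q, ps, hV⟩ := hValg
  obtain ⟨R₀, hR₀, hcard⟩ := hLgen
  have hLc : Continuous L := L.continuous_of_finiteDimensional
  have hb : ∀ u : Fin m → ℂ, ∃ B : ℝ, ∀ v : Fin s → ℂ,
      (∀ i, MvPolynomial.eval (Sum.elim u v) (ps i) = 0) → ∀ j, ‖v j‖ ≤ B := by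
    intro u
    obtain ⟨B, hB⟩ := (hVprop {u} (Set.subset_univ _) isCompact_singleton).isBounded.exists_norm_le
    refine ⟨B, fun v hv j => (norm_le_pi_norm v j).trans ((norm_snd_le (u, v)).trans
      (hB _ ⟨?_, rfl⟩))⟩
    rw [hV]
    exact hv
  have hdesc : ∀ u t, pEval u t P = 0 ↔ ∃ v, (u, v) ∈ V ∧ L v = t := by
    intro u t
    have h := Set.ext_iff.1 hPdesc (u, t)
    rw [Set.mem_ofPred_eq] at h
    rw [← h]
    constructor
    · rintro ⟨⟨u', v⟩, hv, he⟩
      obtain ⟨rfl, rfl⟩ := Prod.mk.inj he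
      exact ⟨v, hv, rfl⟩
    · rintro ⟨v, hv, rfl⟩
      exact ⟨(u, v), hv, rfl⟩
  have hgen : ∀ u, MvPolynomial.eval u R₀ ≠ 0 → Set.InjOn L {v | (u, v) ∈ V} := by
    intro u hu
    refine Set.injOn_of_ncard_image_eq ?_ (by rw [hV]; exact finite_fiber ps hb u)
    rw [hcard u hu, hPdesc]
    congr 1
    ext t
    exact (hdesc u t).symm
  have hinj : ∀ u, MvPolynomial.eval u R ≠ 0 → Set.InjOn L {v | (u, v) ∈ V} := fun u hu =>
    injOn_fiber_of_simple_roots ps hV hVdim hVprop hb hR₀ hgen hPmonic hdesc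
      fun z hz hz' => hu ((hRdisc u).2 ⟨z, hz, hz'⟩)
  have hchoice : ∀ ν, ∃ G : (Fin n → ℂ) → Fin s → ℂ, DifferentiableOn ℂ G U ∧
      ((∃ x ∈ U, MvPolynomial.eval (fν ν x) R ≠ 0) →
        ∀ x ∈ U, (fν ν x, G x) ∈ V ∧ L (G x) = tν ν x) := by
    intro ν
    by_cases h : ∃ x ∈ U, MvPolynomial.eval (fν ν x) R ≠ 0
    · obtain ⟨G, hG, hGV⟩ := exists_differentiableOn_lift hU hUc.isPreconnected ps hV hVprop hb hinj
        (hfν ν) (htν ν) (fun x hx => (hdesc _ _).1 (hPν ν x hx)) h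
      exact ⟨G, hG, fun _ => hGV⟩
    · exact ⟨fun _ => 0, differentiableOn_const _, fun h' => (h h').elim⟩
  choose gν hgν hgνV using hchoice
  have hev : ∀ᶠ ν in atTop, ∀ x ∈ U, (fν ν x, gν ν x) ∈ V ∧ L (gν ν x) = tν ν x := by
    obtain ⟨x, hx, hxR⟩ := hRf
    filter_upwards [((MvPolynomial.differentiable_eval R).continuous.continuousAt.tendsto.comp
      (hfνconv.tendsto_at hx)).eventually_ne hxR] with ν hν
    exact hgνV ν ⟨x, hx, hν⟩
  have hjoint : ∀ {F : Type} [NormedAddCommGroup F] {φ : ℕ → (Fin n → ℂ) → F}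
      {φ₀ : (Fin n → ℂ) → F}, TendstoLocallyUniformlyOn φ φ₀ atTop U →
      ContinuousOn φ₀ U → ∀ x ∈ U,
      Tendsto (fun y : ℕ × (Fin n → ℂ) => φ y.1 y.2) (atTop ×ˢ 𝓝 x) (𝓝 (φ₀ x)) := by
    intro F _ φ φ₀ hφ hφ₀ x hx
    have h1 := tendstoLocallyUniformlyOn_iff_forall_tendsto.1 hφ x hx
    rw [hU.nhdsWithin_eq hx] at h1
    have h2 : Tendsto (fun y : ℕ × (Fin n → ℂ) => φ₀ y.2) (atTop ×ˢ 𝓝 x) (𝓝 (φ₀ x)) :=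
      (hφ₀.continuousAt (hU.mem_nhds hx)).tendsto.comp tendsto_snd
    exact h2.congr_uniformity h1
  have hgc := hg.continuousOn
  refine ⟨gν, hgν, ?_, hev.mono fun ν hν x hx => (hν x hx).1⟩
  refine tendstoLocallyUniformlyOn_of_inter_ne_zero hU hUc.isPreconnected
    ((MvPolynomial.differentiable_eval R).comp_differentiableOn hf) hRf hgν hg ?_
  refine tendstoLocallyUniformlyOn_iff_forall_tendsto.2 fun x hx => ?_
  have hmem : ∀ᶠ y : ℕ × (Fin n → ℂ) in atTop ×ˢ 𝓝 x,
      (fν y.1 y.2, gν y.1 y.2) ∈ V ∧ L (gν y.1 y.2) = tν y.1 y.2 :=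
    (hev.prod_mk (hU.mem_nhds hx.1)).mono fun y hy => hy.1 y.2 hy.2
  have hlim : Tendsto (fun y : ℕ × (Fin n → ℂ) => gν y.1 y.2) (atTop ×ˢ 𝓝 x) (𝓝 (g x)) := by
    refine hVprop.tendsto_of_unique (hmem.mono fun y hy => hy.1)
      (hjoint hfνconv hf.continuousOn x hx.1) fun v hv hvc =>
        hinj _ hx.2 hv (hfgV x hx.1) ?_
    refine (hvc.continuousAt_comp hLc.continuousAt).eq_of_tendsto ?_
    exact (hjoint htνconv (hLc.comp_continuousOn hgc) x hx.1).congr'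
      (hmem.mono fun y hy => hy.2.symm)
  have h2 : Tendsto (fun y : ℕ × (Fin n → ℂ) => g y.2) (atTop ×ˢ 𝓝 x) (𝓝 (g x)) :=
    (hgc.continuousAt (hU.mem_nhds hx.1)).tendsto.comp tendsto_snd
  exact ((h2.prodMk_nhds hlim).mono_left
    (prod_mono le_rfl nhdsWithin_le_nhds)).mono_right (nhds_le_uniformity (g x))
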